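/- Let S ⊆ ℝⁿ (n ≥ 2) be a centrally symmetric convex body of class C²₊ (C² boundary with everywhere strictly positive Gauss curvature). Then there is a nonnegative function ψ with ψ(Δ) → 0 as Δ → 0 such that for every x ∈ ∂S and every sufficiently small Δ > 0, |conv(S ∪ {x + Δ·u(x)})|ₙ − |S|ₙ ≤ ((2Δ)^{(n+1)/2}/(n(n+1)))·(|B₂^{n−1}|_{n−1}/κ(x)^{1/2})·(1 + ψ(Δ)). -/

import Mathlib

open MeasureTheory Metric Set Filter
open scoped RealInnerProductSpace Pointwise Topology

noncomputable section

abbrev Euc (n : ℕ) : Type := EuclideanSpace ℝ (Fin n)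

/-- A centrally symmetric convex body in `ℝⁿ`. -/
def IsSymConvexBody {n : ℕ} (S : Set (Euc n)) : Prop :=
  IsCompact S ∧ Convex ℝ S ∧ (interior S).Nonempty ∧ S = -S

/-- The convex floating body `K_δ`: the intersection of all closed halfspaces whose bounding
hyperplane cuts off a set of volume at most `δ·|K|ₙ` from `K`. -/
def floatingBody {n : ℕ} (K : Set (Euc n)) (δ : ℝ) : Set (Euc n) :=
  ⋂ (v : Euc n) (_ : v ≠ 0) (c : ℝ)
    (_ : volume (K ∩ {y | c ≤ ⟪v, y⟫}) ≤ ENNReal.ofReal δ * volume K),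
    {y | ⟪v, y⟫ ≤ c}

/-- The illumination body `K^δ`. -/
def illuminationBody {n : ℕ} (K : Set (Euc n)) (δ : ℝ) : Set (Euc n) :=
  {x | volume (convexHull ℝ (K ∪ {x})) ≤ ENNReal.ofReal (1 + δ) * volume K}

/-- The polar body `K°`. -/
def polarBody {n : ℕ} (K : Set (Euc n)) : Set (Euc n) :=
  {y | ∀ x ∈ K, ⟪x, y⟫ ≤ 1}

/-- The distance `d(C₁, C₂) = inf {a ≥ 1 : a⁻¹ C₁ ⊆ C₂ ⊆ a C₁}`. -/
def bodyDist {n : ℕ} (C₁ C₂ : Set (Euc n)) : ℝ :=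
  sInf {a : ℝ | 1 ≤ a ∧ a⁻¹ • C₁ ⊆ C₂ ∧ C₂ ⊆ a • C₁}

/-- `d_C(δ) = inf_{δ' > 0} d(C_δ, ((C°)^{δ'})°)`. -/
def dualDist {n : ℕ} (C : Set (Euc n)) (δ : ℝ) : ℝ :=
  sInf {r : ℝ | ∃ δ' > (0:ℝ), r = bodyDist (floatingBody C δ)
      (polarBody (illuminationBody (polarBody C) δ'))}

/-- `ν` is an outer unit normal of `S` at `x`. -/
def IsOuterNormalAt {n : ℕ} (S : Set (Euc n)) (x ν : Euc n) : Prop :=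
  ‖ν‖ = 1 ∧ ∀ y ∈ S, ⟪y, ν⟫ ≤ ⟪x, ν⟫

/-- Near `x ∈ ∂S`, the boundary of `S` is the graph of a `C²` function `f` over the tangent
hyperplane at `x` (embedded via a linear isometry `L` orthogonal to the normal `ν`), with
`f 0 = 0` and vanishing derivative at `0`, and `k` is the determinant of the Hessian of `f`
at `0`, i.e. the Gauss curvature of `∂S` at `x`. -/
def IsGaussCurvatureAt {n : ℕ} (S : Set (Euc n)) (x ν : Euc n) (k : ℝ) : Prop :=
  ∃ (L : Euc (n-1) →ₗᵢ[ℝ] Euc n) (f : Euc (n-1) → ℝ) (τ ε : ℝ),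
    0 < τ ∧ 0 < ε ∧
    (∀ v, ⟪L v, ν⟫ = 0) ∧
    ContDiffOn ℝ 2 f (ball 0 τ) ∧
    f 0 = 0 ∧ fderiv ℝ f 0 = 0 ∧
    frontier S ∩ ball x ε
      = {y | ∃ v ∈ ball (0 : Euc (n-1)) τ, y = x + L v - f v • ν} ∩ ball x ε ∧
    k = (Matrix.of fun i j : Fin (n-1) =>
      iteratedFDeriv ℝ 2 f 0 ![EuclideanSpace.single i 1, EuclideanSpace.single j 1]).det

/-- `S` has `C²` boundary, with outer unit normal map `u` and Gauss curvature function `κ`. -/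
def IsC2Body {n : ℕ} (S : Set (Euc n)) (u : Euc n → Euc n) (κ : Euc n → ℝ) : Prop :=
  ∀ x ∈ frontier S, IsOuterNormalAt S x (u x) ∧ IsGaussCurvatureAt S x (u x) (κ x)

/-- The constant `c(K, n) = ((n+1)^{2/(n+1)}/2)·(|K|ₙ/|B₂^{n−1}|_{n−1})^{2/(n+1)}`. -/
def cConst (n : ℕ) (K : Set (Euc n)) : ℝ :=
  ((n + 1 : ℝ) ^ ((2:ℝ)/(n+1)) / 2) *
    ((volume K).toReal / (volume (ball (0 : Euc (n-1)) 1)).toReal) ^ ((2:ℝ)/(n+1))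

/-- The function `G_S(x) = c(S,n)·κ(x)^{1/(n+1)} / ⟨x, u(x)⟩`. -/
def Gfun {n : ℕ} (S : Set (Euc n)) (u : Euc n → Euc n) (κ : Euc n → ℝ) (x : Euc n) : ℝ :=
  cConst n S * (κ x) ^ ((1:ℝ)/(n+1)) / ⟪x, u x⟫

section Coordinates

variable {E F : Type*} [NormedAddCommGroup E] [InnerProductSpace ℝ E]
  [NormedAddCommGroup F] [InnerProductSpace ℝ F]

/-- The point with base coordinate `v` and depth `t` in the frame at `x` given by `L` and `ν`. -/
def graphPoint (x ν : E) (L : F →ₗᵢ[ℝ] E) (v : F) (t : ℝ) : E := x + L v - t • ν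

theorem continuous_graphPoint (x ν : E) (L : F →ₗᵢ[ℝ] E) :
    Continuous fun p : F × ℝ => graphPoint x ν L p.1 p.2 := by
  unfold graphPoint
  have := L.continuous
  fun_prop

/-- Coordinates of a hyperplane and its normal as a linear isometry. -/
def frameIsometry (ν : E) (L : F →ₗᵢ[ℝ] E) (hν : ‖ν‖ = 1) (hL : ∀ v, ⟪L v, ν⟫ = 0) :
    WithLp 2 (F × ℝ) →ₗᵢ[ℝ] E where
  toFun p := L p.fst - p.snd • ν
  map_add' p q := by simp [add_smul]; abel
  map_smul' c p := by simp [smul_sub, mul_smul]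
  norm_map' p := by
    have h : ‖L p.fst - p.snd • ν‖ ^ 2 = ‖p‖ ^ 2 := by
      rw [WithLp.prod_norm_sq_eq_of_L2, norm_sub_sq_real]
      simp [real_inner_smul_right, hL, norm_smul, hν]
    exact (sq_eq_sq₀ (norm_nonneg _) (norm_nonneg _)).1 h

theorem graphPoint_sub (x ν : E) (L : F →ₗᵢ[ℝ] E) (v : F) (t : ℝ) :
    graphPoint x ν L v t - x = L v - t • ν := by
  rw [graphPoint]; abel

theorem graphPoint_depth {x ν : E} {L : F →ₗᵢ[ℝ] E} (hν : ‖ν‖ = 1) (hL : ∀ v, ⟪L v, ν⟫ = 0)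
    (v : F) (t : ℝ) : -⟪graphPoint x ν L v t - x, ν⟫ = t := by
  rw [graphPoint_sub, inner_sub_left, real_inner_smul_left, hL, real_inner_self_eq_norm_sq,
    hν]
  simp

theorem graphPoint_inj {x ν : E} {L : F →ₗᵢ[ℝ] E} (hν : ‖ν‖ = 1) (hL : ∀ v, ⟪L v, ν⟫ = 0)
    {v v' : F} {t t' : ℝ} (h : graphPoint x ν L v t = graphPoint x ν L v' t') :
    v = v' ∧ t = t' := by
  have ht : t = t' := by
    rw [← graphPoint_depth (x := x) hν hL v t, h, graphPoint_depth hν hL]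
  subst ht
  exact ⟨L.injective (by simpa [graphPoint] using h), rfl⟩

variable [FiniteDimensional ℝ E] [FiniteDimensional ℝ F]

theorem exists_graphPoint_eq {ν : E} {L : F →ₗᵢ[ℝ] E} (hν : ‖ν‖ = 1) (hL : ∀ v, ⟪L v, ν⟫ = 0)
    (hdim : Module.finrank ℝ E = Module.finrank ℝ F + 1) (x y : E) :
    ∃ v t, y = graphPoint x ν L v t := by
  have hd : Module.finrank ℝ (WithLp 2 (F × ℝ)) = Module.finrank ℝ E := by
    rw [hdim, (WithLp.linearEquiv 2 ℝ (F × ℝ)).finrank_eq, Module.finrank_prod,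
      Module.finrank_self]
  obtain ⟨p, hp⟩ := ((frameIsometry ν L hν hL).toLinearIsometryEquiv hd).surjective (y - x)
  refine ⟨p.fst, p.snd, ?_⟩
  have : L p.fst - p.snd • ν = y - x := hp
  rw [graphPoint, add_sub_assoc, this]; abel

theorem graphPoint_base {x ν : E} {L : F →ₗᵢ[ℝ] E} (hL : ∀ v, ⟪L v, ν⟫ = 0) (v : F) (t : ℝ) :
    L.toContinuousLinearMap.adjoint (graphPoint x ν L v t - x) = v := by
  refine ext_inner_right ℝ fun w => ?_
  rw [ContinuousLinearMap.adjoint_inner_left]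
  rw [graphPoint_sub, LinearIsometry.coe_toContinuousLinearMap, inner_sub_left,
    real_inner_smul_left, real_inner_comm (L w) ν, hL, L.inner_map_map, mul_zero, sub_zero]

variable [MeasurableSpace E] [BorelSpace E] [MeasurableSpace F] [BorelSpace F]

theorem volume_image_graphPoint {ν : E} {L : F →ₗᵢ[ℝ] E} (hν : ‖ν‖ = 1)
    (hL : ∀ v, ⟪L v, ν⟫ = 0) (hdim : Module.finrank ℝ E = Module.finrank ℝ F + 1) (x : E)
    {D : Set (F × ℝ)} (hD : MeasurableSet D) :
    volume ((fun p : F × ℝ => graphPoint x ν L p.1 p.2) '' D) = volume D := by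
  have hd : Module.finrank ℝ (WithLp 2 (F × ℝ)) = Module.finrank ℝ E := by
    rw [hdim, (WithLp.linearEquiv 2 ℝ (F × ℝ)).finrank_eq, Module.finrank_prod,
      Module.finrank_self]
  set e := (frameIsometry ν L hν hL).toLinearIsometryEquiv hd with he
  have himg : (fun p : F × ℝ => graphPoint x ν L p.1 p.2) '' D
      = (fun y => x + y) '' (e.symm ⁻¹' (WithLp.ofLp ⁻¹' D)) := by
    ext y
    constructor
    · rintro ⟨p, hp, rfl⟩
      refine ⟨e (WithLp.toLp 2 p), by simpa using hp, ?_⟩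
      change x + (L p.1 - p.2 • ν) = x + L p.1 - p.2 • ν
      abel
    · rintro ⟨z, hz, rfl⟩
      refine ⟨(e.symm z).ofLp, hz, ?_⟩
      have : L (e.symm z).fst - (e.symm z).snd • ν = z := e.apply_symm_apply z
      change graphPoint x ν L (e.symm z).fst (e.symm z).snd = x + z
      rw [graphPoint, add_sub_assoc, this]
  have hD' : MeasurableSet ((WithLp.ofLp : WithLp 2 (F × ℝ) → F × ℝ) ⁻¹' D) :=
    (WithLp.volume_preserving_ofLp F ℝ).measurable hD
  rw [himg]
  have : (fun y => x + y) '' (e.symm ⁻¹' (WithLp.ofLp ⁻¹' D))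
      = x +ᵥ (e.symm ⁻¹' (WithLp.ofLp ⁻¹' D)) := rfl
  rw [this, measure_vadd, e.symm.measurePreserving.measure_preimage hD'.nullMeasurableSet,
    (WithLp.volume_preserving_ofLp F ℝ).measure_preimage hD.nullMeasurableSet]
  
end Coordinates

section LocalGraph

variable {E F : Type*} [NormedAddCommGroup E] [InnerProductSpace ℝ E]
  [NormedAddCommGroup F] [InnerProductSpace ℝ F]

/-- In the cylinder of radius `ρ` and half-height `d` at `x`, the set `S` is the region below the
graph of `f`. -/
structure IsLocalGraph (S : Set E) (x ν : E) (L : F →ₗᵢ[ℝ] E) (f : F → ℝ) (ρ d : ℝ) : Prop where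
  radius_pos : 0 < ρ
  height_pos : 0 < d
  abs_apply_lt : ∀ v, ‖v‖ < ρ → |f v| < d
  mem_iff : ∀ v t, ‖v‖ < ρ → |t| < d → (graphPoint x ν L v t ∈ S ↔ f v ≤ t)
  mem_frontier_iff : ∀ v t, ‖v‖ < ρ → |t| < d → (graphPoint x ν L v t ∈ frontier S ↔ t = f v)

theorem IsLocalGraph.mono {S : Set E} {x ν : E} {L : F →ₗᵢ[ℝ] E} {f : F → ℝ} {ρ d ρ' : ℝ}
    (h : IsLocalGraph S x ν L f ρ d) (h0 : 0 < ρ') (hρ : ρ' ≤ ρ) :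
    IsLocalGraph S x ν L f ρ' d where
  radius_pos := h0
  height_pos := h.height_pos
  abs_apply_lt v hv := h.abs_apply_lt v (hv.trans_le hρ)
  mem_iff v t hv := h.mem_iff v t (hv.trans_le hρ)
  mem_frontier_iff v t hv := h.mem_frontier_iff v t (hv.trans_le hρ)

theorem norm_graphPoint_sub_le {x ν : E} (hν : ‖ν‖ = 1) (L : F →ₗᵢ[ℝ] E) (v : F) (t : ℝ) :
    ‖graphPoint x ν L v t - x‖ ≤ ‖v‖ + |t| := by
  rw [graphPoint_sub]
  refine (norm_sub_le _ _).trans ?_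
  rw [L.norm_map, norm_smul, hν, mul_one, Real.norm_eq_abs]

theorem isPreconnected_between {x ν : E} {L : F →ₗᵢ[ℝ] E} {f : F → ℝ} {ρ c : ℝ}
    (hf : ContinuousOn f (ball 0 ρ)) :
    IsPreconnected ((fun p : F × ℝ => graphPoint x ν L p.1 (f p.1 + p.2 * (c - f p.1))) ''
      (ball (0 : F) ρ ×ˢ Ioo (0 : ℝ) 1)) := by
  refine ((convex_ball 0 ρ).isPreconnected.prod isPreconnected_Ioo).image _ ?_
  have h1 : ContinuousOn (fun p : F × ℝ => f p.1) (ball (0 : F) ρ ×ˢ Ioo (0 : ℝ) 1) :=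
    hf.comp continuousOn_fst fun p hp => hp.1
  have h2 : ContinuousOn (fun p : F × ℝ => (p.1, f p.1 + p.2 * (c - f p.1)))
      (ball (0 : F) ρ ×ˢ Ioo (0 : ℝ) 1) :=
    continuousOn_fst.prodMk (h1.add (continuousOn_snd.mul (continuousOn_const.sub h1)))
  exact (continuous_graphPoint x ν L).comp_continuousOn h2

theorem graphPoint_mem_between {x ν : E} {L : F →ₗᵢ[ℝ] E} {f : F → ℝ} {ρ c t : ℝ} {v : F}
    (hv : ‖v‖ < ρ) (ht : f v < t ∧ t < c ∨ c < t ∧ t < f v) :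
    graphPoint x ν L v t ∈
      (fun p : F × ℝ => graphPoint x ν L p.1 (f p.1 + p.2 * (c - f p.1))) ''
      (ball (0 : F) ρ ×ˢ Ioo (0 : ℝ) 1) := by
  have hne : c - f v ≠ 0 := by
    rcases ht with h | h
    · exact ne_of_gt (by linarith)
    · exact ne_of_lt (by linarith)
  refine ⟨(v, (t - f v) / (c - f v)), ⟨by simpa using hv, ?_⟩, ?_⟩
  · rcases ht with h | h
    · exact ⟨div_pos (by linarith) (by linarith), (div_lt_one (by linarith)).2 (by linarith)⟩
    · exact ⟨div_pos_of_neg_of_neg (by linarith) (by linarith),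
        (div_lt_one_of_neg (by linarith)).2 (by linarith)⟩
  · simp only
    congr 1
    field_simp
    ring

theorem exists_isLocalGraph {S : Set E} (hcl : IsClosed S) (hconv : Convex ℝ S)
    (hint : (interior S).Nonempty) {x ν : E} (hx : x ∈ frontier S) (hν : ‖ν‖ = 1)
    (hS : ∀ y ∈ S, ⟪y, ν⟫ ≤ ⟪x, ν⟫) {L : F →ₗᵢ[ℝ] E} (hL : ∀ v, ⟪L v, ν⟫ = 0)
    (hspan : ∀ y, ∃ v t, y = graphPoint x ν L v t) {f : F → ℝ} {τ ε : ℝ}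
    (hτ : 0 < τ) (hε : 0 < ε) (hf : ContinuousOn f (ball 0 τ)) (hf0 : f 0 = 0)
    (hfr : frontier S ∩ ball x ε
      = {y | ∃ v ∈ ball (0 : F) τ, y = x + L v - f v • ν} ∩ ball x ε) :
    ∃ ρ d, ρ ≤ τ ∧ IsLocalGraph S x ν L f ρ d := by
  set d := ε / 2 with hd
  have hd0 : 0 < d := by positivity
  have hfat : ContinuousAt f 0 := hf.continuousAt (ball_mem_nhds _ hτ)
  obtain ⟨δ, hδ, hfδ⟩ := Metric.continuousAt_iff.1 hfat d hd0
  set ρ := min τ (min δ d) with hρ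
  have hρ0 : 0 < ρ := by positivity
  have hρτ : ρ ≤ τ := min_le_left _ _
  have hρδ : ρ ≤ δ := (min_le_right _ _).trans (min_le_left _ _)
  have hρd : ρ ≤ d := (min_le_right _ _).trans (min_le_right _ _)
  have habs : ∀ v, ‖v‖ < ρ → |f v| < d := fun v hv => by
    have := hfδ (x := v) (by simpa using hv.trans_le hρδ)
    simpa [hf0, Real.dist_eq] using this
  have hball : ∀ v t, ‖v‖ < ρ → |t| < d → graphPoint x ν L v t ∈ ball x ε := fun v t hv ht => by
    rw [mem_ball, dist_eq_norm]
    have := norm_graphPoint_sub_le (x := x) hν L v t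
    linarith
  have hfront : ∀ v t, ‖v‖ < ρ → |t| < d →
      (graphPoint x ν L v t ∈ frontier S ↔ t = f v) := fun v t hv ht => by
    have hb := hball v t hv ht
    constructor
    · intro h
      have : graphPoint x ν L v t ∈ frontier S ∩ ball x ε := ⟨h, hb⟩
      rw [hfr] at this
      obtain ⟨⟨v', -, h'⟩, -⟩ := this
      obtain ⟨rfl, h2⟩ := graphPoint_inj hν hL (show _ = graphPoint x ν L v' (f v') from h')
      exact h2
    · rintro rfl
      have : graphPoint x ν L v (f v) ∈
          {y | ∃ v ∈ ball (0 : F) τ, y = x + L v - f v • ν} ∩ ball x ε :=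
        ⟨⟨v, by simpa using hv.trans_le hρτ, rfl⟩, hb⟩
      rw [← hfr] at this
      exact this.1
  have hfρ : ContinuousOn f (ball 0 ρ) := hf.mono (ball_subset_ball hρτ)
  have hdisj : Disjoint (interior S) Sᶜ :=
    disjoint_compl_right.mono_left interior_subset
  have hcover : ∀ y, y ∉ frontier S → y ∈ interior S ∪ Sᶜ := fun y hy => by
    rw [hcl.frontier_eq] at hy
    by_cases h : y ∈ S
    · left; by_contra h'; exact hy ⟨h, h'⟩
    · exact Or.inr h
  have hbet : ∀ c, |c| ≤ d → (∀ v, ‖v‖ < ρ → f v ≠ c) →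
      (fun p : F × ℝ => graphPoint x ν L p.1 (f p.1 + p.2 * (c - f p.1))) ''
      (ball (0 : F) ρ ×ˢ Ioo (0 : ℝ) 1) ⊆ interior S ∪ Sᶜ := by
    rintro c hc hne _ ⟨⟨v, s⟩, ⟨hv, hs⟩, rfl⟩
    have hv' : ‖v‖ < ρ := by simpa using hv
    refine hcover _ fun h => ?_
    have h1 := abs_lt.1 (habs v hv')
    have h2 := abs_le.1 hc
    have h3 : f v + s * (c - f v) = (1 - s) * f v + s * c := by ring
    have hs1 : s < 1 := hs.2
    have hs0 : 0 < s := hs.1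
    have := (hfront v _ hv' (by
      rw [h3, abs_lt]; constructor <;> nlinarith)).1 h
    have : s * (c - f v) = 0 := by linarith
    rcases mul_eq_zero.1 this with h | h
    · linarith
    · exact hne v hv' (by linarith)
  have hx0 : x = graphPoint x ν L 0 0 := by simp [graphPoint]
  have hout : ∀ v t, ‖v‖ < ρ → |t| < d → t < f v → graphPoint x ν L v t ∉ S := by
    intro v t hv ht htf
    have hsub := (isPreconnected_between (x := x) (ν := ν) (L := L) (c := -d)
      hfρ).subset_right_of_subset_union isOpen_interior hcl.isOpen_compl hdisj
      (hbet (-d) (by simp [abs_of_pos hd0])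
        fun v hv => by have := abs_lt.1 (habs v hv); linarith) ?_
    · exact hsub (graphPoint_mem_between hv (Or.inr ⟨(abs_lt.1 ht).1, htf⟩))
    · refine ⟨graphPoint x ν L 0 (-(d / 2)), graphPoint_mem_between (by simpa)
        (Or.inr ⟨by linarith, by rw [hf0]; linarith⟩), fun h => ?_⟩
      have h1 := hS _ h
      have h2 := graphPoint_depth (x := x) hν hL 0 (-(d / 2))
      rw [inner_sub_left] at h2
      linarith
  have hin : ∀ v t, ‖v‖ < ρ → |t| < d → f v < t → graphPoint x ν L v t ∈ S := by
    intro v t hv ht htf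
    have hsub := (isPreconnected_between (x := x) (ν := ν) (L := L) (c := d)
      hfρ).subset_left_of_subset_union isOpen_interior hcl.isOpen_compl hdisj
      (hbet d (by simp [abs_of_pos hd0])
        fun v hv => by have := abs_lt.1 (habs v hv); linarith) ?_
    · exact interior_subset (hsub (graphPoint_mem_between hv (Or.inl ⟨htf, (abs_lt.1 ht).2⟩)))
    · have hxc : x ∈ closure (interior S) := by
        rw [hconv.closure_interior_eq_closure_of_nonempty_interior hint]
        exact frontier_subset_closure hx
      obtain ⟨z, hz, hzx⟩ := Metric.mem_closure_iff.1 hxc ρ hρ0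
      obtain ⟨w, s, rfl⟩ := hspan z
      have hn : ‖graphPoint x ν L w s - x‖ < ρ := by
        rwa [← dist_eq_norm, dist_comm]
      have hsq : ‖graphPoint x ν L w s - x‖ ^ 2 = ‖w‖ ^ 2 + s ^ 2 := by
        rw [graphPoint_sub, norm_sub_sq_real]
        simp [real_inner_smul_right, hL, norm_smul, hν]
      have hw : ‖w‖ < ρ := by
        refine lt_of_le_of_lt (abs_le_of_sq_le_sq' ?_ (norm_nonneg _)).2 hn
        nlinarith
      have hs : |s| < d := by
        refine lt_of_le_of_lt (abs_le_of_sq_le_sq ?_ (norm_nonneg _)) (hn.trans_le hρd)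
        nlinarith [norm_nonneg w]
      refine ⟨_, graphPoint_mem_between hw (Or.inl ⟨?_, (abs_lt.1 hs).2⟩), hz⟩
      rcases lt_trichotomy s (f w) with h | h | h
      · exact absurd (interior_subset hz) (hout w s hw hs h)
      · have := (hfront w s hw hs).2 h
        exact absurd hz this.2
      · exact h
  refine ⟨ρ, d, hρτ, hρ0, hd0, habs, fun v t hv ht => ⟨fun h => ?_, fun h => ?_⟩, hfront⟩
  · by_contra hlt
    exact hout v t hv ht (not_le.1 hlt) h
  · rcases h.lt_or_eq with h | h
    · exact hin v t hv ht h
    · exact hcl.frontier_subset ((hfront v t hv ht).2 h.symm)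

end LocalGraph

section Taylor

/-- A second-order Taylor expansion that is uniform in the base point. -/
theorem exists_uniform_taylor {F : Type*} [NormedAddCommGroup F] [NormedSpace ℝ F] {f : F → ℝ}
    (hf : ContDiffAt ℝ 2 f 0) {η : ℝ} (hη : 0 < η) :
    ∃ r > 0, ∀ v w, ‖v‖ < r → ‖w‖ < r →
      |f w - f v - fderiv ℝ f v (w - v) - fderiv ℝ (fderiv ℝ f) 0 (w - v) (w - v) / 2|
        ≤ η * ‖w - v‖ ^ 2 := by
  set B := fderiv ℝ (fderiv ℝ f) 0 with hB
  have hsymm : ∀ a b, B a b = B b a := hf.isSymmSndFDerivAt (by simp)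
  have h1 : ContDiffAt ℝ 1 (fderiv ℝ f) 0 := hf.fderiv_right (by norm_num)
  have hs : HasStrictFDerivAt (fderiv ℝ f) B 0 := h1.hasStrictFDerivAt (by norm_num)
  obtain ⟨r₁, hr₁, hdiff⟩ := Metric.eventually_nhds_iff.1
    ((hf.eventually (by simp)).mono fun x hx => hx.differentiableAt (by norm_num))
  have hlo := hs.isLittleO.def hη
  rw [nhds_prod_eq, Filter.eventually_prod_self_iff'] at hlo
  obtain ⟨s, hs, hlip⟩ := hlo
  obtain ⟨r₂, hr₂, hsub⟩ := Metric.mem_nhds_iff.1 hs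
  refine ⟨min r₁ r₂, lt_min hr₁ hr₂, fun v w hv hw => ?_⟩
  set C := ball (0 : F) (min r₁ r₂) ∩ closedBall v ‖w - v‖ with hC
  have hconv : Convex ℝ C := (convex_ball _ _).inter (convex_closedBall _ _)
  have hvC : v ∈ C := ⟨by simpa using hv, by simp⟩
  have hwC : w ∈ C := ⟨by simpa using hw, by simp [dist_eq_norm]⟩
  have hderiv : ∀ z ∈ C, HasFDerivWithinAt
      (fun z => f z - fderiv ℝ f v (z - v) - B (z - v) (z - v) / 2)
      (fderiv ℝ f z - fderiv ℝ f v - B (z - v)) C z := by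
    intro z hz
    have hz1 : ‖z‖ < min r₁ r₂ := by simpa using hz.1
    have hfz : HasFDerivAt f (fderiv ℝ f z) z :=
      (hdiff (by simpa using hz1.trans_le (min_le_left _ _))).hasFDerivAt
    have hid : HasFDerivAt (fun z => z - v) (ContinuousLinearMap.id ℝ F) z :=
      (hasFDerivAt_id z).sub_const v
    have h2 := (fderiv ℝ f v).hasFDerivAt.comp z hid
    have h3 := (B.hasFDerivAt.comp z hid).clm_apply hid
    have h4 := (hfz.sub h2).sub (h3.mul_const (1 / 2))
    refine (HasFDerivAt.congr_fderiv (h4.congr_of_eventuallyEq ?_) ?_).hasFDerivWithinAt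
    · exact Eventually.of_forall fun y => by simp [div_eq_mul_inv]
    · ext k
      simp
      rw [← map_sub]
      have := hsymm k (z - v)
      simp only [map_sub, sub_apply] at this ⊢
      linarith
  have hbd : ∀ z ∈ C, ‖fderiv ℝ f z - fderiv ℝ f v - B (z - v)‖ ≤ η * ‖w - v‖ := by
    intro z hz
    have hz1 : ‖z‖ < min r₁ r₂ := by simpa using hz.1
    refine (hlip z (hsub (by simpa using hz1.trans_le (min_le_right _ _))) _
      (hsub (by simpa using hv.trans_le (min_le_right _ _)))).trans ?_
    gcongr
    simpa [dist_eq_norm] using hz.2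
  have := hconv.norm_image_sub_le_of_norm_hasFDerivWithin_le hderiv hbd hvC hwC
  rw [Real.norm_eq_abs] at this
  calc _ = |f w - fderiv ℝ f v (w - v) - B (w - v) (w - v) / 2 -
        (f v - fderiv ℝ f v (v - v) - B (v - v) (v - v) / 2)| := by
        congr 1; simp; ring
    _ ≤ η * ‖w - v‖ * ‖w - v‖ := this
    _ = _ := by ring

/-- A nonnegative symmetric bilinear form is the pullback of the inner product by a linear map. -/
theorem exists_norm_sq_eq_bilin {m : ℕ}
    (B : EuclideanSpace ℝ (Fin m) →L[ℝ] EuclideanSpace ℝ (Fin m) →L[ℝ] ℝ)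
    (hsymm : ∀ a b, B a b = B b a) (hpos : ∀ a, 0 ≤ B a a) :
    ∃ M : EuclideanSpace ℝ (Fin m) →ₗ[ℝ] EuclideanSpace ℝ (Fin m),
      (∀ w, B w w = ‖M w‖ ^ 2) ∧
      (Matrix.of fun i j : Fin m =>
        B (EuclideanSpace.single i 1) (EuclideanSpace.single j 1)).det = LinearMap.det M ^ 2 := by
  set H : Matrix (Fin m) (Fin m) ℝ := Matrix.of fun i j : Fin m =>
    B (EuclideanSpace.single i 1) (EuclideanSpace.single j 1) with hH
  have hquad : ∀ w : EuclideanSpace ℝ (Fin m), B w w = w.ofLp ⬝ᵥ (H.mulVec w.ofLp) := by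
    intro w
    have hw : w = ∑ i, w i • EuclideanSpace.single i (1 : ℝ) := by
      have := ((EuclideanSpace.basisFun (Fin m) ℝ).sum_repr w).symm
      simpa using this
    conv_lhs => rw [hw]
    simp only [map_sum, map_smul, _root_.sum_apply, _root_.smul_apply,
      dotProduct, Matrix.mulVec, Finset.mul_sum, smul_eq_mul, hH, Matrix.of_apply]
    rw [Finset.sum_comm]
    exact Finset.sum_congr rfl fun i _ => Finset.sum_congr rfl fun j _ => by ring
  have hpsd : H.PosSemidef := by
    refine Matrix.PosSemidef.of_dotProduct_mulVec_nonneg ?_ fun x => ?_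
    · ext i j
      simp [hH, hsymm]
    · have := hpos (WithLp.toLp 2 x)
      rw [hquad] at this
      simpa using this
  obtain ⟨N, hN⟩ : ∃ N : Matrix (Fin m) (Fin m) ℝ, H = N.transpose * N := by
    open scoped MatrixOrder ComplexOrder Matrix.Norms.L2Operator in
    obtain ⟨N, hN⟩ := CStarAlgebra.nonneg_iff_eq_star_mul_self.mp hpsd.nonneg
    exact ⟨N, by simpa [Matrix.star_eq_conjTranspose] using hN⟩
  refine ⟨Matrix.toLpLin 2 2 N, fun w => ?_, ?_⟩
  · rw [hquad, hN, EuclideanSpace.real_norm_sq_eq, Matrix.toLpLin_apply, ← Matrix.mulVec_mulVec,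
      Matrix.dotProduct_mulVec, Matrix.vecMul_transpose]
    simp [dotProduct, sq]
  · rw [LinearMap.det_toLpLin, hN, Matrix.det_mul, Matrix.det_transpose, sq]

end Taylor

section Cap

variable {E F : Type*} [NormedAddCommGroup E] [InnerProductSpace ℝ E]
  [NormedAddCommGroup F] [InnerProductSpace ℝ F]

theorem graphPoint_combo (x ν : E) (L : F →ₗᵢ[ℝ] E) (v v' : F) (t t' : ℝ) {a b : ℝ}
    (hab : a + b = 1) :
    a • graphPoint x ν L v t + b • graphPoint x ν L v' t'
      = graphPoint x ν L (a • v + b • v') (a * t + b * t') := by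
  obtain rfl : b = 1 - a := by linarith
  simp only [graphPoint, map_add, map_smul]
  module

/-- The outer unit normal at a point of a local graph, in terms of the derivative. -/
theorem IsLocalGraph.exists_inner_normal {S : Set E} {x ν : E} {L : F →ₗᵢ[ℝ] E} {f : F → ℝ}
    {ρ d : ℝ} (h : IsLocalGraph S x ν L f ρ d) (hν : ‖ν‖ = 1)
    (hspan : ∀ y, ∃ v t, y = graphPoint x ν L v t) {v₀ : F} (hv₀ : ‖v₀‖ < ρ)
    (hf : DifferentiableAt ℝ f v₀) {u : E} (hu : ‖u‖ = 1)
    (hS : ∀ y ∈ S, ⟪y, u⟫ ≤ ⟪graphPoint x ν L v₀ (f v₀), u⟫) :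
    ∃ a, 0 < a ∧ a ≤ 1 ∧ ∀ v t, ⟪graphPoint x ν L v t - graphPoint x ν L v₀ (f v₀), u⟫
      = a * (f v₀ + fderiv ℝ f v₀ (v - v₀) - t) := by
  set a := ⟪ν, u⟫ with ha
  have hexp : ∀ v t, ⟪graphPoint x ν L v t - graphPoint x ν L v₀ (f v₀), u⟫
      = ⟪L (v - v₀), u⟫ - (t - f v₀) * a := fun v t => by
    have : graphPoint x ν L v t - graphPoint x ν L v₀ (f v₀) = L (v - v₀) - (t - f v₀) • ν := by
      simp only [graphPoint, map_sub]; module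
    rw [this, inner_sub_left, real_inner_smul_left]
  have hle : ∀ v t, graphPoint x ν L v t ∈ S → ⟪L (v - v₀), u⟫ - (t - f v₀) * a ≤ 0 :=
    fun v t hm => by
      rw [← hexp, inner_sub_left]
      linarith [hS _ hm]
  have h0 := abs_lt.1 (h.abs_apply_lt v₀ hv₀)
  have ha0 : 0 ≤ a := by
    have hd := h.height_pos
    set t := (f v₀ + d) / 2 with ht
    have := hle v₀ t ((h.mem_iff v₀ t hv₀ (abs_lt.2 ⟨by linarith, by linarith⟩)).2 (by linarith))
    simp only [sub_self, map_zero, inner_zero_left, zero_sub] at this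
    have h2 : 0 < t - f v₀ := by linarith
    nlinarith
  have hmax : IsLocalMax (fun v => ⟪L (v - v₀), u⟫ - (f v - f v₀) * a) v₀ := by
    have : ball (0 : F) ρ ∈ 𝓝 v₀ := isOpen_ball.mem_nhds (by simpa using hv₀)
    filter_upwards [this] with v hv
    have hv' : ‖v‖ < ρ := by simpa using hv
    simpa using hle v (f v) ((h.mem_iff v _ hv' (h.abs_apply_lt v hv')).2 le_rfl)
  have hder : ∀ w, ⟪L w, u⟫ = a * fderiv ℝ f v₀ w := by
    intro w
    have h1 : HasFDerivAt (fun v => ⟪u, L (v - v₀)⟫)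
        ((innerSL ℝ u).comp L.toContinuousLinearMap) v₀ :=
      ((innerSL ℝ u).comp L.toContinuousLinearMap).hasFDerivAt.comp v₀
        ((hasFDerivAt_id v₀).sub_const v₀)
    have h2 := h1.sub ((hf.hasFDerivAt.sub_const (f v₀)).mul_const a)
    have h3 := (hmax.congr (Eventually.of_forall fun v => by
      simp only [real_inner_comm u, Pi.sub_apply])).hasFDerivAt_eq_zero h2
    have h4 := congrArg (fun φ : F →L[ℝ] ℝ => φ w) h3
    simp at h4
    rw [real_inner_comm]
    linarith
  have hane : a ≠ 0 := by
    intro hz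
    obtain ⟨v, t, hvt⟩ := hspan (x + u)
    have hu' : u = L v - t • ν := by
      have := congrArg (fun y => y - x) hvt
      simpa [graphPoint_sub] using this
    have : ⟪u, u⟫ = 0 := by
      nth_rewrite 1 [hu']
      rw [inner_sub_left, real_inner_smul_left, hder, ← ha, hz]; ring
    rw [real_inner_self_eq_norm_sq, hu] at this
    norm_num at this
  refine ⟨a, ha0.lt_of_ne' hane, ?_, fun v t => ?_⟩
  · have := real_inner_le_norm ν u
    rwa [hν, hu, mul_one] at this
  · rw [hexp, hder]; ring

/-- A local graph whose defining function is `C²`-close to a quadratic form, with its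
supporting halfspaces. -/
structure IsNearlyQuadratic (S : Set E) (x ν : E) (L : F →ₗᵢ[ℝ] E) (f : F → ℝ) (ρ d : ℝ)
    (M : F →ₗ[ℝ] F) (C ξ : ℝ) : Prop extends IsLocalGraph S x ν L f ρ d where
  const_pos : 0 < C
  error_pos : 0 < ξ
  error_le : ξ ≤ 1 / 10
  norm_le : ∀ w, ‖w‖ ≤ C * ‖M w‖
  taylor : ∀ v w, ‖v‖ < ρ → ‖w‖ < ρ →
    |f w - f v - fderiv ℝ f v (w - v) - ‖M (w - v)‖ ^ 2 / 2| ≤ ξ / 2 * ‖M (w - v)‖ ^ 2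
  fderiv_le : ∀ v, ‖v‖ < ρ → ‖fderiv ℝ f v‖ ≤ ξ
  support : ∀ v, ‖v‖ < ρ → ∀ w t, graphPoint x ν L w t ∈ S → f v + fderiv ℝ f v (w - v) ≤ t

variable {S : Set E} {x ν : E} {L : F →ₗᵢ[ℝ] E} {f : F → ℝ} {ρ d : ℝ} {M : F →ₗ[ℝ] F} {C ξ : ℝ}

theorem IsNearlyQuadratic.support_hull (h : IsNearlyQuadratic S x ν L f ρ d M C ξ)
    {v₀ b : F} {c Δ : ℝ} (hb : ‖b‖ ≤ 1) (hc : |c| ≤ 1) (hΔ : 0 < Δ)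
    {v₁ : F} (hv₁ : ‖v₁‖ < ρ) {w : F} {s : ℝ} (hw : graphPoint x ν L w s ∈ S)
    {α β : ℝ} (hα : 0 ≤ α) (hβ : 0 ≤ β) (hαβ : α + β = 1) :
    min 0 (f v₀ - f v₁ - fderiv ℝ f v₁ (v₀ - v₁) - Δ * (1 + ξ)) ≤
      (α * (f v₀ + Δ * c) + β * s) - f v₁
        - fderiv ℝ f v₁ ((α • (v₀ + Δ • b) + β • w) - v₁) := by
  have h1 := h.support v₁ hv₁ w s hw
  have h2 : |fderiv ℝ f v₁ b| ≤ ξ := by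
    have := (fderiv ℝ f v₁).le_opNorm b
    have h3 := h.fderiv_le v₁ hv₁
    rw [Real.norm_eq_abs] at this
    nlinarith [norm_nonneg b, norm_nonneg (fderiv ℝ f v₁)]
  have h3 := (abs_le.1 h2).2
  have h4 := (abs_le.1 hc).1
  set m := min 0 (f v₀ - f v₁ - fderiv ℝ f v₁ (v₀ - v₁) - Δ * (1 + ξ)) with hm
  have hm0 : m ≤ 0 := min_le_left _ _
  have hm1 : m ≤ f v₀ - f v₁ - fderiv ℝ f v₁ (v₀ - v₁) - Δ * (1 + ξ) := min_le_right _ _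
  simp only [map_sub, map_add, map_smul, smul_eq_mul] at h1 hm1 ⊢
  have h5 : m ≤ f v₀ + Δ * c - f v₁ -
      (fderiv ℝ f v₁ v₀ + Δ * fderiv ℝ f v₁ b - fderiv ℝ f v₁ v₁) := by
    nlinarith
  have h6 : m ≤ s - f v₁ - (fderiv ℝ f v₁ w - fderiv ℝ f v₁ v₁) := by linarith
  have hα' : α = 1 - β := by linarith
  have h7 := mul_le_mul_of_nonneg_left h5 hα
  have h8 := mul_le_mul_of_nonneg_left h6 hβ
  have h9 : m = α * m + β * m := by rw [← add_mul, hαβ, one_mul]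
  rw [h9]
  refine (add_le_add h7 h8).trans (le_of_eq ?_)
  rw [hα']; ring

/-- Estimates on the part of the convex hull of `S` and a nearby point that lies outside `S`,
for points already known to be close. -/
theorem IsNearlyQuadratic.cap_bounds (h : IsNearlyQuadratic S x ν L f ρ d M C ξ)
    {v₀ : F} {Δ : ℝ} (hΔ : 0 < Δ) (hv₀ : ‖v₀‖ < ρ / 4)
    (hCΔ : C * √(2 * Δ) ≤ ρ / 16)
    {v : F} {t : ℝ} (hv : ‖v‖ < ρ) (ht : |t| < d) (hout : graphPoint x ν L v t ∉ S)
    (hsupp : ∀ v₁, ‖v₁‖ < ρ →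
      min 0 (f v₀ - f v₁ - fderiv ℝ f v₁ (v₀ - v₁) - Δ * (1 + ξ)) ≤
        t - f v₁ - fderiv ℝ f v₁ (v - v₁)) :
    ‖M (v - v₀)‖ / √(2 * Δ) ≤ 1 + 2 * ξ ∧
    Δ * (2 * (1 - ξ) * (‖M (v - v₀)‖ / √(2 * Δ)) - 1 - 3 * ξ)
      ≤ t - f v₀ - fderiv ℝ f v₀ (v - v₀) ∧
    t - f v₀ - fderiv ℝ f v₀ (v - v₀) ≤ Δ * (1 + ξ) * (‖M (v - v₀)‖ / √(2 * Δ)) ^ 2 := by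
  have hρ := h.radius_pos
  have hξ := h.error_pos
  have hξ' := h.error_le
  have hv₀' : ‖v₀‖ < ρ := by linarith
  set R := √(2 * Δ) with hR
  have hR0 : 0 < R := Real.sqrt_pos.2 (by linarith)
  have hR2 : R ^ 2 = 2 * Δ := Real.sq_sqrt (by linarith)
  set r := ‖M (v - v₀)‖ / R with hr
  have hr0 : 0 ≤ r := by positivity
  have hMr : ‖M (v - v₀)‖ = r * R := by rw [hr]; field_simp
  have htf : t < f v := by
    by_contra hcon
    exact hout ((h.mem_iff v t hv ht).2 (not_lt.1 hcon))
  have hMneg : ‖M (v₀ - v)‖ = ‖M (v - v₀)‖ := by rw [← neg_sub, map_neg, norm_neg]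
  refine ⟨?_, ?_, ?_⟩
  · have h1 := hsupp v hv
    have h2 := (abs_le.1 (h.taylor v v₀ hv hv₀')).1
    rw [hMneg, hMr] at h2
    simp only [sub_self, map_zero, sub_zero] at h1
    have h3 : min 0 (f v₀ - f v - fderiv ℝ f v (v₀ - v) - Δ * (1 + ξ)) < 0 := by linarith
    have h4 : f v₀ - f v - fderiv ℝ f v (v₀ - v) < Δ * (1 + ξ) := by
      rcases min_lt_iff.1 h3 with h | h <;> linarith
    have h5 : (1 - ξ) * (r ^ 2 * Δ) < Δ * (1 + ξ) := by
      have : (r * R) ^ 2 = 2 * (r ^ 2 * Δ) := by rw [mul_pow, hR2]; ring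
      rw [this] at h2
      linarith
    have h6 : (1 - ξ) * r ^ 2 < 1 + ξ := by nlinarith
    by_contra hcon
    push Not at hcon
    have : (1 + 2 * ξ) ^ 2 < r ^ 2 := by gcongr
    have h7 := mul_lt_mul_of_pos_left this (by linarith : 0 < 1 - ξ)
    have h8 : ξ ^ 2 ≤ 1 / 100 := by nlinarith
    have h9 := mul_le_mul_of_nonneg_left h8 hξ.le
    nlinarith
  · by_cases hw : v = v₀
    · have h1 := hsupp v₀ hv₀'
      subst hw
      simp only [sub_self, map_zero, sub_zero, norm_zero] at h1 hr ⊢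
      rw [hr, zero_div]
      have : min 0 (0 - Δ * (1 + ξ)) = - (Δ * (1 + ξ)) := by
        rw [zero_sub, min_eq_right]; nlinarith
      simp only [zero_sub] at this h1
      rw [this] at h1
      nlinarith
    · have hwne : 0 < ‖v - v₀‖ := norm_pos_iff.2 (sub_ne_zero.2 hw)
      have hrpos : 0 < r := by
        have := h.norm_le (v - v₀)
        have hCp := h.const_pos
        have : 0 < ‖M (v - v₀)‖ := by
          by_contra hcon
          nlinarith [norm_nonneg (M (v - v₀))]
        positivity
      obtain ⟨ws, hws⟩ : ∃ ws, ws = r⁻¹ • (v - v₀) := ⟨_, rfl⟩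
      have hwr : v - v₀ = r • ws := by rw [hws, smul_smul, mul_inv_cancel₀ hrpos.ne', one_smul]
      have hMws : ‖M ws‖ = R := by
        rw [hws, map_smul, norm_smul, hMr, norm_inv, Real.norm_of_nonneg hr0]
        field_simp
      have hv₁ : ‖v₀ + ws‖ < ρ := by
        have h1 := h.norm_le ws
        rw [hMws] at h1
        linarith [norm_add_le v₀ ws]
      have h1 := hsupp (v₀ + ws) hv₁
      have e1 : v₀ + ws - v₀ = ws := by abel
      have e2 : v₀ - (v₀ + ws) = -ws := by abel
      have e3 : v - (v₀ + ws) = (r - 1) • ws := by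
        rw [sub_smul, ← hwr, one_smul]; abel
      have hT1 := abs_le.1 (h.taylor v₀ (v₀ + ws) hv₀' hv₁)
      have hT2 := abs_le.1 (h.taylor (v₀ + ws) v₀ hv₁ hv₀')
      rw [e1, hMws, hR2] at hT1
      rw [e2, map_neg, map_neg, norm_neg, hMws, hR2] at hT2
      rw [e2, e3, map_neg, map_smul, smul_eq_mul] at h1
      rw [hwr, map_smul, smul_eq_mul]
      have h2 : -2 * ξ * Δ ≤
          min 0 (f v₀ - f (v₀ + ws) - -(fderiv ℝ f (v₀ + ws)) ws - Δ * (1 + ξ)) := by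
        refine le_min (by nlinarith) (by linarith [hT2.1])
      have h3 : r * (2 * (1 - ξ) * Δ)
          ≤ r * (fderiv ℝ f (v₀ + ws) ws - fderiv ℝ f v₀ ws) :=
        mul_le_mul_of_nonneg_left (by linarith [hT1.1, hT2.1]) hr0
      linarith [hT2.2]
  · have h2 := (abs_le.1 (h.taylor v₀ v hv₀' hv)).2
    rw [hMr] at h2
    have : (r * R) ^ 2 = 2 * (r ^ 2 * Δ) := by rw [mul_pow, hR2]; ring
    rw [this] at h2
    linarith

set_option maxHeartbeats 800000 in
/-- The part of the convex hull of `S` and a nearby point that lies outside `S` is contained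
in an explicit region. -/
theorem IsNearlyQuadratic.hull_diff (h : IsNearlyQuadratic S x ν L f ρ d M C ξ)
    (hconv : Convex ℝ S) (hne : S.Nonempty)
    (hspan : ∀ y, ∃ v t, y = graphPoint x ν L v t)
    {v₀ b : F} {c Δ : ℝ} (hb : ‖b‖ ≤ 1) (hc : |c| ≤ 1) (hΔ : 0 < Δ) (hv₀ : ‖v₀‖ < ρ / 4)
    (hfv₀ : |f v₀| < d / 4) (hCρ : C * √(2 * Δ) ≤ ρ / 16) (hCd : C * √(2 * Δ) ≤ d / 64)
    (hΔρ : Δ ≤ ρ / 16) (hΔd : Δ ≤ d / 64) {q : E}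
    (hq : q ∈ convexHull ℝ (S ∪ {graphPoint x ν L (v₀ + Δ • b) (f v₀ + Δ * c)})) (hqS : q ∉ S) :
    ∃ v t, q = graphPoint x ν L v t ∧ ‖M (v - v₀)‖ / √(2 * Δ) ≤ 1 + 2 * ξ ∧
    Δ * (2 * (1 - ξ) * (‖M (v - v₀)‖ / √(2 * Δ)) - 1 - 3 * ξ)
      ≤ t - f v₀ - fderiv ℝ f v₀ (v - v₀) ∧
    t - f v₀ - fderiv ℝ f v₀ (v - v₀) ≤ Δ * (1 + ξ) * (‖M (v - v₀)‖ / √(2 * Δ)) ^ 2 := by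
  have hρ := h.radius_pos
  have hd := h.height_pos
  have hξ := h.error_pos
  have hξ' := h.error_le
  rw [union_singleton, convexHull_insert hne, hconv.convexHull_eq, mem_convexJoin] at hq
  obtain ⟨p, hp, y, hy, hqy⟩ := hq
  rw [mem_singleton_iff] at hp
  subst hp
  obtain ⟨vy, ty, rfl⟩ := hspan y
  obtain ⟨α, β, hα, hβ, hαβ, rfl⟩ := hqy
  obtain rfl : α = 1 - β := by linarith
  rw [graphPoint_combo _ _ _ _ _ _ _ hαβ] at hqS ⊢
  have hβ1 : β < 1 := by
    refine lt_of_le_of_ne (by linarith) ?_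
    rintro rfl
    simp at hqS
    exact hqS hy
  set V : ℝ → F := fun s => (1 - s) • (v₀ + Δ • b) + s • vy with hV
  set T : ℝ → ℝ := fun s => (1 - s) * (f v₀ + Δ * c) + s * ty with hT
  have hnot : ∀ s, 0 ≤ s → s ≤ β → graphPoint x ν L (V s) (T s) ∉ S := by
    intro s hs0 hsβ hmem
    apply hqS
    have h1s : 0 < 1 - s := by linarith
    have hsum : (1 - β) / (1 - s) + (β - s) / (1 - s) = 1 := by field_simp; ring
    have := hconv hmem hy (div_nonneg (by linarith) h1s.le : 0 ≤ (1 - β) / (1 - s))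
      (div_nonneg (by linarith) h1s.le : 0 ≤ (β - s) / (1 - s)) hsum
    rw [graphPoint_combo _ _ _ _ _ _ _ hsum] at this
    convert this using 2
    · simp only [hV, smul_add, smul_smul]
      have e1 : (1 - β) / (1 - s) * (1 - s) = 1 - β := by field_simp
      have e2 : β = (1 - β) / (1 - s) * s + (β - s) / (1 - s) := by field_simp; ring
      rw [e1, add_assoc ((1 - β) • v₀ + _), ← add_smul, ← e2, ← mul_assoc, e1]
    · simp only [hT]
      field_simp
      ring
  have key : ∀ s, 0 ≤ s → s ≤ β → ‖V s‖ < ρ → |T s| < d →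
      ‖M (V s - v₀)‖ / √(2 * Δ) ≤ 1 + 2 * ξ ∧
      Δ * (2 * (1 - ξ) * (‖M (V s - v₀)‖ / √(2 * Δ)) - 1 - 3 * ξ)
        ≤ T s - f v₀ - fderiv ℝ f v₀ (V s - v₀) ∧
      T s - f v₀ - fderiv ℝ f v₀ (V s - v₀)
        ≤ Δ * (1 + ξ) * (‖M (V s - v₀)‖ / √(2 * Δ)) ^ 2 :=
    fun s hs0 hsβ hvs hts => h.cap_bounds hΔ hv₀ hCρ hvs hts (hnot s hs0 hsβ)
      fun v₁ hv₁ => h.support_hull hb hc hΔ hv₁ hy (by linarith) hs0 (by ring)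
  have hsmall : ∀ s, 0 ≤ s → s ≤ β → ‖V s‖ < ρ → |T s| < d →
      ‖V s‖ < ρ / 2 ∧ |T s| < d / 2 := by
    intro s hs0 hsβ hvs hts
    obtain ⟨k1, k2, k3⟩ := key s hs0 hsβ hvs hts
    set r := ‖M (V s - v₀)‖ / √(2 * Δ) with hr
    have hR0 : 0 < √(2 * Δ) := Real.sqrt_pos.2 (by linarith)
    have hr0 : 0 ≤ r := by positivity
    have hn : ‖V s - v₀‖ ≤ r * (C * √(2 * Δ)) := by
      refine (h.norm_le _).trans (le_of_eq ?_)
      rw [hr]; field_simp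
    have hr2 : r ≤ 2 := by linarith
    have hCR : 0 ≤ C * √(2 * Δ) := mul_nonneg h.const_pos.le hR0.le
    have hn2 : ‖V s - v₀‖ ≤ 2 * (C * √(2 * Δ)) := hn.trans (by gcongr)
    have hfd : |fderiv ℝ f v₀ (V s - v₀)| ≤ 2 * (C * √(2 * Δ)) := by
      have h1 := (fderiv ℝ f v₀).le_opNorm (V s - v₀)
      have h2 := h.fderiv_le v₀ (by linarith)
      rw [Real.norm_eq_abs] at h1
      refine h1.trans (le_trans ?_ hn2)
      exact mul_le_of_le_one_left (norm_nonneg _) (by linarith)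
    constructor
    · have := norm_add_le v₀ (V s - v₀)
      rw [add_sub_cancel] at this
      linarith
    · have hfd' := abs_le.1 hfd
      have hfv' := abs_lt.1 hfv₀
      have h4 : Δ * (1 + ξ) * r ^ 2 ≤ 5 * Δ := by
        have h6 : r ^ 2 ≤ 4 := by nlinarith
        have h7 : (1 + ξ) * r ^ 2 ≤ 5 := by nlinarith [sq_nonneg r]
        nlinarith
      have h5 : -(2 * Δ) ≤ Δ * (2 * (1 - ξ) * r - 1 - 3 * ξ) := by
        have : 0 ≤ (1 - ξ) * r := mul_nonneg (by linarith) hr0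
        nlinarith
      rw [abs_lt]
      constructor <;> linarith
  have hcont : Continuous fun s => max (‖V s‖ / ρ) (|T s| / d) := by
    simp only [hV, hT]
    fun_prop
  have hstart : max (‖V 0‖ / ρ) (|T 0| / d) < 1 / 2 := by
    have e1 : V 0 = v₀ + Δ • b := by simp [hV]
    have e2 : T 0 = f v₀ + Δ * c := by simp [hT]
    rw [max_lt_iff, div_lt_iff₀ hρ, div_lt_iff₀ hd, e1, e2]
    have h1 := norm_add_le v₀ (Δ • b)
    have h2 := abs_add_le (f v₀) (Δ * c)
    rw [norm_smul, Real.norm_of_nonneg hΔ.le] at h1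
    rw [abs_mul, abs_of_pos hΔ] at h2
    have h3 : Δ * ‖b‖ ≤ Δ := mul_le_of_le_one_right hΔ.le hb
    have h4 : Δ * |c| ≤ Δ := mul_le_of_le_one_right hΔ.le hc
    constructor <;> linarith
  have hend : max (‖V β‖ / ρ) (|T β| / d) < 1 / 2 := by
    by_contra hcon
    obtain ⟨s, hs, hs2⟩ := intermediate_value_Icc hβ hcont.continuousOn
      (show (1 / 2 : ℝ) ∈ Icc _ _ from ⟨hstart.le, not_lt.1 hcon⟩)
    simp only at hs2
    have h1 : ‖V s‖ / ρ ≤ 1 / 2 := hs2 ▸ le_max_left _ _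
    have h2 : |T s| / d ≤ 1 / 2 := hs2 ▸ le_max_right _ _
    rw [div_le_iff₀ hρ] at h1
    rw [div_le_iff₀ hd] at h2
    obtain ⟨h3, h4⟩ := hsmall s hs.1 hs.2 (by linarith) (by linarith)
    have : max (‖V s‖ / ρ) (|T s| / d) < 1 / 2 := by
      rw [max_lt_iff, div_lt_iff₀ hρ, div_lt_iff₀ hd]
      constructor <;> linarith
    linarith
  rw [max_lt_iff, div_lt_iff₀ hρ, div_lt_iff₀ hd] at hend
  exact ⟨V β, T β, rfl, key β hβ le_rfl (by linarith) (by linarith)⟩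

end Cap

section CapVolume

open Module

variable {F : Type*} [NormedAddCommGroup F] [InnerProductSpace ℝ F] [FiniteDimensional ℝ F]
  [MeasurableSpace F] [BorelSpace F]

theorem integral_pow_mul_one_sub_sq {m : ℕ} (hm : 1 ≤ m) :
    ∫ y in Ioi (0 : ℝ), y ^ (m - 1) * max (1 - y) 0 ^ 2
      = 2 / ((m : ℝ) * (m + 1) * (m + 2)) := by
  obtain ⟨k, rfl⟩ : ∃ k, m = k + 1 := ⟨m - 1, by omega⟩
  have h1 : ∫ y in Ioi (0 : ℝ), y ^ (k + 1 - 1) * max (1 - y) 0 ^ 2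
      = ∫ y in Ioc (0 : ℝ) 1, y ^ (k + 1 - 1) * max (1 - y) 0 ^ 2 := by
    refine setIntegral_eq_of_subset_of_forall_sdiff_eq_zero measurableSet_Ioi
      Ioc_subset_Ioi_self fun y hy => ?_
    have : 1 < y := by
      by_contra hcon
      exact hy.2 ⟨hy.1, not_lt.1 hcon⟩
    rw [max_eq_right (by linarith)]; simp
  have h2 : ∫ y in Ioc (0 : ℝ) 1, y ^ (k + 1 - 1) * max (1 - y) 0 ^ 2
      = ∫ y in Ioc (0 : ℝ) 1, (y ^ k - 2 * y ^ (k + 1) + y ^ (k + 2)) := by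
    refine setIntegral_congr_fun measurableSet_Ioc fun y hy => ?_
    simp only [Nat.add_sub_cancel]
    rw [max_eq_left (by linarith [hy.2])]; ring
  rw [h1, h2, ← intervalIntegral.integral_of_le zero_le_one, intervalIntegral.integral_add,
    intervalIntegral.integral_sub, intervalIntegral.integral_const_mul, integral_pow,
    integral_pow, integral_pow]
  · push_cast
    simp
    field_simp
    ring
  all_goals exact Continuous.intervalIntegrable (by fun_prop) _ _

theorem lintegral_one_sub_norm_sq [Nontrivial F] :
    ∫⁻ z : F, ENNReal.ofReal (max (1 - ‖z‖) 0 ^ 2)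
      = ENNReal.ofReal ((volume (ball (0 : F) 1)).toReal *
          (2 / (((finrank ℝ F : ℝ) + 1) * (finrank ℝ F + 2)))) := by
  have hm : 1 ≤ finrank ℝ F := finrank_pos
  rw [← ofReal_integral_eq_lintegral_ofReal]
  · congr 1
    have h := integral_fun_norm_addHaar (volume : Measure F) fun y => max (1 - y) 0 ^ 2
    rw [h]
    simp only [smul_eq_mul, nsmul_eq_mul]
    rw [integral_pow_mul_one_sub_sq hm, Measure.real]
    have : (0 : ℝ) < finrank ℝ F := by exact_mod_cast hm
    field_simp
  · refine Continuous.integrable_of_hasCompactSupport (by fun_prop) ?_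
    refine HasCompactSupport.intro (isCompact_closedBall (0 : F) 1) fun z hz => ?_
    have : 1 < ‖z‖ := by simpa using hz
    rw [max_eq_right (by linarith)]; simp
  · exact Eventually.of_forall fun z => by positivity

theorem lintegral_comp_linearMap_sub (T : F →ₗ[ℝ] F) (hT : LinearMap.det T ≠ 0) (v₀ : F)
    {G : F → ENNReal} (hG : Measurable G) :
    ∫⁻ v, G (T (v - v₀)) = ENNReal.ofReal |(LinearMap.det T)⁻¹| * ∫⁻ z, G z := by
  rw [lintegral_sub_right_eq_self (fun v => G (T v)) v₀,
    ← lintegral_map hG T.continuous_of_finiteDimensional.measurable,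
    Measure.map_linearMap_addHaar_eq_smul_addHaar _ hT, lintegral_smul_measure, smul_eq_mul]

/-- Volume of the explicit region containing a small cap. -/
theorem volume_cap_region_le [Nontrivial F] (M : F →ₗ[ℝ] F) (hM : LinearMap.det M ≠ 0)
    (ℓ : F →L[ℝ] ℝ) (v₀ : F) (a : ℝ) {ξ Δ : ℝ} (hξ : 0 < ξ) (hξ' : ξ ≤ 1 / 10) (hΔ : 0 < Δ) :
    MeasurableSet {p : F × ℝ | ‖M (p.1 - v₀)‖ / √(2 * Δ) ≤ 1 + 2 * ξ ∧
      Δ * (2 * (1 - ξ) * (‖M (p.1 - v₀)‖ / √(2 * Δ)) - 1 - 3 * ξ) ≤ p.2 - a - ℓ (p.1 - v₀) ∧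
      p.2 - a - ℓ (p.1 - v₀) ≤ Δ * (1 + ξ) * (‖M (p.1 - v₀)‖ / √(2 * Δ)) ^ 2} ∧
    volume {p : F × ℝ | ‖M (p.1 - v₀)‖ / √(2 * Δ) ≤ 1 + 2 * ξ ∧
      Δ * (2 * (1 - ξ) * (‖M (p.1 - v₀)‖ / √(2 * Δ)) - 1 - 3 * ξ) ≤ p.2 - a - ℓ (p.1 - v₀) ∧
      p.2 - a - ℓ (p.1 - v₀) ≤ Δ * (1 + ξ) * (‖M (p.1 - v₀)‖ / √(2 * Δ)) ^ 2} ≤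
    ENNReal.ofReal (√(2 * Δ) ^ finrank ℝ F * |LinearMap.det M|⁻¹ * (Δ *
      ((volume (ball (0 : F) 1)).toReal * (2 / (((finrank ℝ F : ℝ) + 1) * (finrank ℝ F + 2))) +
        12 * ξ * (volume (closedBall (0 : F) 2)).toReal))) := by
  have hMc : Continuous M := M.continuous_of_finiteDimensional
  set R := √(2 * Δ) with hR
  have hR0 : 0 < R := Real.sqrt_pos.2 (by linarith)
  set D := {p : F × ℝ | ‖M (p.1 - v₀)‖ / R ≤ 1 + 2 * ξ ∧
      Δ * (2 * (1 - ξ) * (‖M (p.1 - v₀)‖ / R) - 1 - 3 * ξ) ≤ p.2 - a - ℓ (p.1 - v₀) ∧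
      p.2 - a - ℓ (p.1 - v₀) ≤ Δ * (1 + ξ) * (‖M (p.1 - v₀)‖ / R) ^ 2} with hD
  have hDm : MeasurableSet D := by
    refine IsClosed.measurableSet ?_
    have hr : Continuous fun p : F × ℝ => ‖M (p.1 - v₀)‖ / R :=
      (hMc.comp (by fun_prop : Continuous fun p : F × ℝ => p.1 - v₀)).norm.div_const R
    have hs : Continuous fun p : F × ℝ => p.2 - a - ℓ (p.1 - v₀) := by fun_prop
    have h1 := isClosed_le hr (continuous_const (y := 1 + 2 * ξ))
    have h2 := isClosed_le (((((continuous_const (y := 2 * (1 - ξ))).mul hr).sub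
      (continuous_const (y := 1))).sub (continuous_const (y := 3 * ξ))).const_mul Δ) hs
    have h3 := isClosed_le hs ((hr.pow 2).const_mul (Δ * (1 + ξ)))
    exact h1.inter (h2.inter h3)
  refine ⟨hDm, ?_⟩
  set T : F →ₗ[ℝ] F := R⁻¹ • M with hT
  have hTdet : LinearMap.det T = R⁻¹ ^ finrank ℝ F * LinearMap.det M := LinearMap.det_smul _ _
  have hTdet0 : LinearMap.det T ≠ 0 := by
    rw [hTdet]; positivity
  have hTn : ∀ w, ‖T w‖ = ‖M w‖ / R := fun w => by
    rw [hT, LinearMap.smul_apply, norm_smul, norm_inv, Real.norm_of_nonneg hR0.le]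
    field_simp
  set G : F → ENNReal := fun z => ENNReal.ofReal Δ * (ENNReal.ofReal (max (1 - ‖z‖) 0 ^ 2) +
    ENNReal.ofReal (12 * ξ) * (closedBall (0 : F) 2).indicator 1 z) with hG
  have hind : Measurable ((closedBall (0 : F) 2).indicator (1 : F → ENNReal)) :=
    measurable_one.indicator measurableSet_closedBall
  have hcm : Measurable fun z : F => ENNReal.ofReal (max (1 - ‖z‖) 0 ^ 2) :=
    (by fun_prop : Continuous fun z : F => max (1 - ‖z‖) 0 ^ 2).measurable.ennreal_ofReal
  have hGm : Measurable G := measurable_const.mul (hcm.add (measurable_const.mul hind))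
  have hslice : ∀ v, volume (Prod.mk v ⁻¹' D) ≤ G (T (v - v₀)) := by
    intro v
    set r := ‖M (v - v₀)‖ / R with hr
    have hr0 : 0 ≤ r := by positivity
    by_cases hr1 : r ≤ 1 + 2 * ξ
    · have hsub : Prod.mk v ⁻¹' D ⊆ Icc (a + ℓ (v - v₀) + Δ * (2 * (1 - ξ) * r - 1 - 3 * ξ))
          (a + ℓ (v - v₀) + Δ * (1 + ξ) * r ^ 2) := by
        rintro t ⟨-, h2, h3⟩
        constructor <;> linarith
      refine (measure_mono hsub).trans ?_
      rw [Real.volume_Icc]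
      have hr2 : r ≤ 2 := by linarith
      have hmem : T (v - v₀) ∈ closedBall (0 : F) 2 := by
        rw [mem_closedBall_zero_iff, hTn]; exact hr2
      simp only [hG, indicator_of_mem hmem, Pi.one_apply, mul_one, hTn]
      rw [← ENNReal.ofReal_add (by positivity) (by positivity),
        ← ENNReal.ofReal_mul hΔ.le]
      apply ENNReal.ofReal_le_ofReal
      have hkey : (1 - r) ^ 2 ≤ max (1 - r) 0 ^ 2 + ξ := by
        rcases le_total r 1 with h | h
        · rw [max_eq_left (by linarith)]; linarith
        · rw [max_eq_right (by linarith)]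
          nlinarith
      have : Δ * ((1 - r) ^ 2 + ξ * (r ^ 2 + 2 * r + 3)) ≤
          Δ * (max (1 - r) 0 ^ 2 + 12 * ξ) := by
        refine mul_le_mul_of_nonneg_left ?_ hΔ.le
        have : r ^ 2 + 2 * r + 3 ≤ 11 := by nlinarith
        nlinarith
      refine le_trans (le_of_eq ?_) this
      ring
    · have : Prod.mk v ⁻¹' D = ∅ := by
        ext t
        simp only [mem_empty_iff_false, iff_false]
        exact fun h => hr1 h.1
      rw [this]; simp
  have hball : volume (closedBall (0 : F) 2) ≠ ⊤ := measure_closedBall_lt_top.ne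
  have hGint : ∫⁻ z, G z = ENNReal.ofReal (Δ *
      ((volume (ball (0 : F) 1)).toReal * (2 / (((finrank ℝ F : ℝ) + 1) * (finrank ℝ F + 2))) +
        12 * ξ * (volume (closedBall (0 : F) 2)).toReal)) := by
    simp only [hG]
    rw [lintegral_const_mul _ (by exact hcm.add (measurable_const.mul hind)),
      lintegral_add_left hcm, lintegral_const_mul _ hind,
      lintegral_indicator_one measurableSet_closedBall, lintegral_one_sub_norm_sq,
      ← ENNReal.ofReal_toReal hball, ← ENNReal.ofReal_mul (by positivity),
      ← ENNReal.ofReal_add (by positivity) (by positivity), ← ENNReal.ofReal_mul hΔ.le,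
      ENNReal.toReal_ofReal (by positivity)]
  calc volume D = ∫⁻ v, volume (Prod.mk v ⁻¹' D) := by
        rw [Measure.volume_eq_prod, Measure.prod_apply hDm]
    _ ≤ ∫⁻ v, G (T (v - v₀)) := lintegral_mono hslice
    _ = ENNReal.ofReal |(LinearMap.det T)⁻¹| * ∫⁻ z, G z :=
        lintegral_comp_linearMap_sub T hTdet0 v₀ hGm
    _ = _ := by
        rw [hGint, ← ENNReal.ofReal_mul (abs_nonneg _)]
        congr 2
        rw [hTdet, mul_inv, inv_pow, inv_inv, abs_mul, abs_of_pos (by positivity : 0 < R ^ _),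
          abs_inv]

end CapVolume

section Chart

theorem eventually_taylor_zero {F : Type*} [NormedAddCommGroup F] [NormedSpace ℝ F] {f : F → ℝ}
    (hf : ContDiffAt ℝ 2 f 0) (hf0 : f 0 = 0) (hf' : fderiv ℝ f 0 = 0) (w : F) {η : ℝ}
    (hη : 0 < η) :
    ∀ᶠ s : ℝ in 𝓝[>] 0,
      |f (s • w) - s ^ 2 * (fderiv ℝ (fderiv ℝ f) 0 w w / 2)| ≤ η * s ^ 2 := by
  obtain ⟨r, hr, h⟩ := exists_uniform_taylor hf (div_pos hη (by positivity : 0 < ‖w‖ ^ 2 + 1))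
  have hlim : Tendsto (fun s : ℝ => ‖s • w‖) (𝓝[>] 0) (𝓝 0) := by
    have : Continuous fun s : ℝ => ‖s • w‖ := by fun_prop
    simpa using (this.tendsto 0).mono_left nhdsWithin_le_nhds
  filter_upwards [hlim.eventually (gt_mem_nhds hr)] with s hs
  have := h 0 (s • w) (by simpa using hr) hs
  rw [hf0, hf'] at this
  simp only [sub_zero, zero_apply, map_smul, smul_apply, smul_eq_mul, mul_zero] at this
  calc _ = |f (s • w) - s * (s * fderiv ℝ (fderiv ℝ f) 0 w w) / 2| := by congr 1; ring
    _ ≤ η / (‖w‖ ^ 2 + 1) * ‖s • w‖ ^ 2 := this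
    _ = η * s ^ 2 * (‖w‖ ^ 2 / (‖w‖ ^ 2 + 1)) := by
      rw [norm_smul, mul_pow, Real.norm_eq_abs, sq_abs]; ring
    _ ≤ η * s ^ 2 :=
      mul_le_of_le_one_right (by positivity) ((div_le_one (by positivity)).2 (by linarith))

variable {n : ℕ} {S : Set (Euc n)} {u : Euc n → Euc n} {κ : Euc n → ℝ}

/-- `f` parametrises the boundary of `S` near `x` over the tangent hyperplane, and `M` is a
square root of its Hessian. -/
structure IsChart (S : Set (Euc n)) (x ν : Euc n) (k : ℝ) (L : Euc (n - 1) →ₗᵢ[ℝ] Euc n)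
    (f : Euc (n - 1) → ℝ) (M : Euc (n - 1) →ₗ[ℝ] Euc (n - 1)) (ρ d : ℝ) : Prop
    extends IsLocalGraph S x ν L f ρ d where
  norm_normal : ‖ν‖ = 1
  inner_eq_zero : ∀ v, ⟪L v, ν⟫ = 0
  span : ∀ x' y, ∃ v t, y = graphPoint x' ν L v t
  contDiffAt : ContDiffAt ℝ 2 f 0
  apply_zero : f 0 = 0
  fderiv_zero : fderiv ℝ f 0 = 0
  hessian : ∀ w, fderiv ℝ (fderiv ℝ f) 0 w w = ‖M w‖ ^ 2
  curvature : k = LinearMap.det M ^ 2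

theorem exists_isChart (hn : 2 ≤ n) (hS : IsSymConvexBody S) (hC2 : IsC2Body S u κ)
    {x : Euc n} (hx : x ∈ frontier S) :
    ∃ L f M ρ d, IsChart S x (u x) (κ x) L f M ρ d := by
  obtain ⟨⟨hν, hsupp⟩, L, f, τ, ε, hτ, hε, hL, hf, hf0, hf', hfr, hk⟩ := hC2 x hx
  have hspan : ∀ x' y, ∃ v t, y = graphPoint x' (u x) L v t :=
    exists_graphPoint_eq hν hL (by simp; omega)
  obtain ⟨ρ, d, -, h⟩ := exists_isLocalGraph hS.1.isClosed hS.2.1 hS.2.2.1 hx hν hsupp hL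
    (hspan x) hτ hε hf.continuousOn hf0 hfr
  have hfa : ContDiffAt ℝ 2 f 0 := hf.contDiffAt (ball_mem_nhds _ hτ)
  have hnonneg : ∀ v, ‖v‖ < ρ → 0 ≤ f v := fun v hv => by
    rw [← graphPoint_depth (x := x) hν hL v (f v), inner_sub_left]
    linarith [hsupp _ ((h.mem_iff v _ hv (h.abs_apply_lt v hv)).2 le_rfl)]
  have hpos : ∀ w, 0 ≤ fderiv ℝ (fderiv ℝ f) 0 w w := by
    intro w
    by_contra hcon
    push Not at hcon
    set b := fderiv ℝ (fderiv ℝ f) 0 w w with hb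
    have hlim : Tendsto (fun s : ℝ => ‖s • w‖) (𝓝[>] 0) (𝓝 0) := by
      have : Continuous fun s : ℝ => ‖s • w‖ := by fun_prop
      simpa using (this.tendsto 0).mono_left nhdsWithin_le_nhds
    obtain ⟨s, hs1, hs2, hs3⟩ := ((eventually_taylor_zero hfa hf0 hf' w
      (by linarith : 0 < -b / 4)).and ((hlim.eventually (gt_mem_nhds h.radius_pos)).and
      self_mem_nhdsWithin)).exists
    have h1 := hnonneg _ hs2
    have h2 := (abs_le.1 hs1).2
    have h3 : 0 < s ^ 2 := pow_pos hs3 2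
    nlinarith
  obtain ⟨M, hM, hdet⟩ := exists_norm_sq_eq_bilin (fderiv ℝ (fderiv ℝ f) 0)
    (hfa.isSymmSndFDerivAt (by simp)) hpos
  refine ⟨L, f, M, ρ, d, h, hν, hL, hspan, hfa, hf0, hf', hM, ?_⟩
  rw [hk, ← hdet]
  congr 2
  ext i j
  simp [iteratedFDeriv_two_apply]

theorem IsChart.exists_isNearlyQuadratic {x : Euc n} {L : Euc (n - 1) →ₗᵢ[ℝ] Euc n}
    {f : Euc (n - 1) → ℝ} {M : Euc (n - 1) →ₗ[ℝ] Euc (n - 1)} {ρ d : ℝ}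
    (h : IsChart S x (u x) (κ x) L f M ρ d) (hC2 : IsC2Body S u κ) (hk : 0 < κ x)
    {ξ : ℝ} (hξ : 0 < ξ) (hξ' : ξ ≤ 1 / 10) :
    ∃ ρ' C, ρ' ≤ ρ ∧ (∀ v, ‖v‖ < ρ' → DifferentiableAt ℝ f v) ∧
      IsNearlyQuadratic S x (u x) L f ρ' d M C ξ := by
  have hdet : LinearMap.det M ≠ 0 := by
    intro h0
    rw [h.curvature, h0] at hk
    norm_num at hk
  obtain ⟨C, hC, hanti⟩ := M.exists_antilipschitzWith
    (LinearMap.ker_eq_bot_of_injective (LinearMap.equivOfDetNeZero M hdet).injective)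
  have hC' : (0 : ℝ) < C := by exact_mod_cast hC
  have hnorm : ∀ w, ‖w‖ ≤ C * ‖M w‖ := fun w => by
    simpa using hanti.le_mul_dist w 0
  obtain ⟨r₁, hr₁, htaylor⟩ := exists_uniform_taylor h.contDiffAt
    (by positivity : 0 < ξ / 2 / (C : ℝ) ^ 2)
  have hcd : ContinuousAt (fderiv ℝ f) 0 :=
    (h.contDiffAt.fderiv_right (m := 1) (by norm_num)).continuousAt
  obtain ⟨r₂, hr₂, hfd⟩ := Metric.continuousAt_iff.1 hcd ξ hξ
  obtain ⟨r₃, hr₃, hdiff⟩ := Metric.eventually_nhds_iff.1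
    ((h.contDiffAt.eventually (by simp)).mono fun y hy => hy.differentiableAt (by norm_num))
  set ρ' := min (min ρ r₁) (min r₂ r₃) with hρ'
  have hρ'0 : 0 < ρ' := lt_min (lt_min h.radius_pos hr₁) (lt_min hr₂ hr₃)
  have l0 : ρ' ≤ ρ := (min_le_left _ _).trans (min_le_left _ _)
  have l1 : ρ' ≤ r₁ := (min_le_left _ _).trans (min_le_right _ _)
  have l2 : ρ' ≤ r₂ := (min_le_right _ _).trans (min_le_left _ _)
  have l3 : ρ' ≤ r₃ := (min_le_right _ _).trans (min_le_right _ _)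
  have hdiff' : ∀ v, ‖v‖ < ρ' → DifferentiableAt ℝ f v := fun v hv =>
    hdiff (by simpa using hv.trans_le l3)
  refine ⟨ρ', C, l0, hdiff', { h.toIsLocalGraph.mono hρ'0 l0 with
    const_pos := hC'
    error_pos := hξ
    error_le := hξ'
    norm_le := hnorm
    taylor := fun v w hv hw => ?_
    fderiv_le := fun v hv => ?_
    support := fun v hv w t hw => ?_ }⟩
  · have h1 := htaylor v w (hv.trans_le l1) (hw.trans_le l1)
    rw [h.hessian] at h1
    refine h1.trans ?_
    have h2 : ‖w - v‖ ^ 2 ≤ (C * ‖M (w - v)‖) ^ 2 := by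
      gcongr
      exact hnorm _
    calc _ ≤ ξ / 2 / (C : ℝ) ^ 2 * (C * ‖M (w - v)‖) ^ 2 := by gcongr
      _ = _ := by field_simp
  · have := hfd (x := v) (by simpa using hv.trans_le l2)
    rw [h.fderiv_zero, dist_zero_right] at this
    exact this.le
  · have hv' := hv.trans_le l0
    have hfrv := (h.mem_frontier_iff v _ hv' (h.abs_apply_lt v hv')).2 rfl
    obtain ⟨hu, hsu⟩ := (hC2 _ hfrv).1
    obtain ⟨a, ha, -, hin⟩ := h.toIsLocalGraph.exists_inner_normal h.norm_normal (h.span x) hv'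
      (hdiff' v hv) hu hsu
    have h1 := hin w t
    rw [inner_sub_left] at h1
    have h2 := hsu _ hw
    by_contra hcon
    push Not at hcon
    have := mul_pos ha (sub_pos.2 hcon)
    linarith

end Chart

section Semicontinuity

theorem abs_det_le_one_of_norm_le {F : Type*} [NormedAddCommGroup F] [InnerProductSpace ℝ F]
    [FiniteDimensional ℝ F] (A : F →ₗ[ℝ] F) (hA : ∀ w, ‖A w‖ ≤ ‖w‖) :
    |LinearMap.det A| ≤ 1 := by
  borelize F
  have h1 := Measure.addHaar_image_linearMap (volume : Measure F) A (ball 0 1)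
  have h2 : volume (A '' ball 0 1) ≤ volume (ball (0 : F) 1) := by
    refine measure_mono ?_
    rintro _ ⟨w, hw, rfl⟩
    rw [mem_ball_zero_iff] at hw ⊢
    exact (hA w).trans_lt hw
  rw [h1] at h2
  have hpos : volume (ball (0 : F) 1) ≠ 0 := (measure_ball_pos _ _ one_pos).ne'
  have hfin : volume (ball (0 : F) 1) ≠ ⊤ := measure_ball_lt_top.ne
  rw [← ENNReal.ofReal_le_one]
  by_contra hcon
  push Not at hcon
  have := ENNReal.mul_lt_mul_left hpos hfin hcon
  rw [one_mul] at this
  exact absurd h2 (not_le.2 this)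

theorem det_sq_le_of_norm_sq_le {F : Type*} [NormedAddCommGroup F] [InnerProductSpace ℝ F]
    [FiniteDimensional ℝ F] (N K : F →ₗ[ℝ] F) {c : ℝ} (hc : 0 < c)
    (h : ∀ w, ‖N w‖ ^ 2 ≤ c * ‖K w‖ ^ 2) :
    LinearMap.det N ^ 2 ≤ c ^ Module.finrank ℝ F * LinearMap.det K ^ 2 := by
  by_cases hK : LinearMap.det K = 0
  · obtain ⟨w, hw, hw0⟩ := (Submodule.ne_bot_iff _).1 (LinearMap.bot_lt_ker_of_det_eq_zero hK).ne'
    have h1 := h w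
    rw [LinearMap.mem_ker.1 hw, norm_zero] at h1
    have h2 : N w = 0 := by
      rw [← norm_eq_zero]
      nlinarith [norm_nonneg (N w)]
    have : LinearMap.det N = 0 := by
      by_contra hN
      exact hw0 ((LinearMap.equivOfDetNeZero N hN).injective
        (h2.trans (map_zero N).symm : N w = N 0))
    rw [this, hK]; simp
  · set e := LinearMap.equivOfDetNeZero K hK with he
    have heK : ∀ w, K (e.symm w) = w := fun w => e.apply_symm_apply w
    set s := √c with hs
    have hs0 : 0 < s := Real.sqrt_pos.2 hc
    have hs2 : s ^ 2 = c := Real.sq_sqrt hc.le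
    have hcontr := abs_det_le_one_of_norm_le (s⁻¹ • (N ∘ₗ (e.symm : F →ₗ[ℝ] F))) fun w => by
      rw [LinearMap.smul_apply, norm_smul, norm_inv, Real.norm_of_nonneg hs0.le,
        inv_mul_le_iff₀ hs0]
      refine le_of_sq_le_sq ?_ (by positivity)
      have := h (e.symm w)
      rw [heK] at this
      rw [mul_pow, hs2]
      exact this
    have hdet : LinearMap.det (e.symm : F →ₗ[ℝ] F) * LinearMap.det K = 1 := by
      rw [← LinearMap.det_comp]
      have : (e.symm : F →ₗ[ℝ] F) ∘ₗ K = LinearMap.id :=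
        LinearMap.ext fun w => e.symm_apply_apply w
      rw [this, LinearMap.det_id]
    rw [LinearMap.det_smul, LinearMap.det_comp] at hcontr
    set g := LinearMap.det (e.symm : F →ₗ[ℝ] F) with hg
    have h3 : (s⁻¹ ^ Module.finrank ℝ F * (LinearMap.det N * g)) ^ 2 ≤ 1 :=
      (sq_le_one_iff_abs_le_one _).2 hcontr
    have hsp : 0 < s ^ Module.finrank ℝ F := by positivity
    have h4 : LinearMap.det N = s ^ Module.finrank ℝ F * LinearMap.det K *
        (s⁻¹ ^ Module.finrank ℝ F * (LinearMap.det N * g)) := by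
      rw [inv_pow]
      field_simp
      linear_combination -LinearMap.det N * hdet
    rw [h4, mul_pow]
    refine (mul_le_of_le_one_right (by positivity) h3).trans (le_of_eq ?_)
    rw [mul_pow, ← pow_mul, mul_comm _ 2, pow_mul, hs2]

theorem tendsto_div_sq {F : Type*} [NormedAddCommGroup F] [NormedSpace ℝ F] {f : F → ℝ}
    (hf : ContDiffAt ℝ 2 f 0) (hf0 : f 0 = 0) (hf' : fderiv ℝ f 0 = 0) (w : F) :
    Tendsto (fun s : ℝ => f (s • w) / s ^ 2) (𝓝[>] 0)
      (𝓝 (fderiv ℝ (fderiv ℝ f) 0 w w / 2)) := by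
  rw [Metric.tendsto_nhds]
  intro η hη
  filter_upwards [eventually_taylor_zero hf hf0 hf' w (half_pos hη), self_mem_nhdsWithin]
    with s hs hs0
  have hs2 : 0 < s ^ 2 := pow_pos hs0 2
  rw [Real.dist_eq]
  have : f (s • w) / s ^ 2 - fderiv ℝ (fderiv ℝ f) 0 w w / 2
      = (f (s • w) - s ^ 2 * (fderiv ℝ (fderiv ℝ f) 0 w w / 2)) / s ^ 2 := by
    rw [sub_div, mul_div_cancel_left₀ _ hs2.ne']
  rw [this, abs_div, abs_of_pos hs2, div_lt_iff₀ hs2]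
  nlinarith

variable {n : ℕ} {S : Set (Euc n)} {u : Euc n → Euc n} {κ : Euc n → ℝ}

/-- Gauss curvature is upper semicontinuous along the boundary. -/
theorem IsChart.curvature_le {x₀ : Euc n} {L L' : Euc (n - 1) →ₗᵢ[ℝ] Euc n}
    {f f' : Euc (n - 1) → ℝ} {M M' : Euc (n - 1) →ₗ[ℝ] Euc (n - 1)} {ρ d ρ' d' r C ξ : ℝ}
    (h : IsChart S x₀ (u x₀) (κ x₀) L f M ρ d)
    (hq : IsNearlyQuadratic S x₀ (u x₀) L f r d M C ξ)
    (hdiff : ∀ v, ‖v‖ < r → DifferentiableAt ℝ f v) (hC2 : IsC2Body S u κ)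
    {x : Euc n} (hx : x ∈ frontier S) {v₀ : Euc (n - 1)} (hv₀ : ‖v₀‖ < r)
    (hxv : x = graphPoint x₀ (u x₀) L v₀ (f v₀))
    (h' : IsChart S x (u x) (κ x) L' f' M' ρ' d') :
    κ x ≤ (1 + ξ) ^ (n - 1) * κ x₀ := by
  have hξ := hq.error_pos
  set P := L.toContinuousLinearMap.adjoint with hP
  have hPn : ∀ y, ‖P y‖ ≤ ‖y‖ := fun y => by
    have h1 : ‖P‖ ≤ 1 := by
      rw [hP, LinearIsometryEquiv.norm_map]
      exact L.norm_toContinuousLinearMap_le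
    exact (P.le_opNorm y).trans (mul_le_of_le_one_left (norm_nonneg _) h1)
  have hPx : P (x - x₀) = v₀ := by rw [hxv]; exact graphPoint_base h.inner_eq_zero _ _
  obtain ⟨hu, hsu⟩ := (hC2 x hx).1
  obtain ⟨a, ha, ha1, hin⟩ := hq.toIsLocalGraph.exists_inner_normal h.norm_normal (h.span x₀)
    hv₀ (hdiff v₀ hv₀) hu (by rw [← hxv]; exact hsu)
  rw [← hxv] at hin
  set A : Euc (n - 1) →ₗ[ℝ] Euc (n - 1) := (P : Euc n →ₗ[ℝ] Euc (n - 1)) ∘ₗ L'.toLinearMap with hA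
  have hAw : ∀ w, A w = P (L' w) := fun w => rfl
  have hAn : ∀ w, ‖A w‖ ≤ ‖w‖ := fun w => (hPn _).trans (L'.norm_map w).le
  have hMc : Continuous M := M.continuous_of_finiteDimensional
  have key : ∀ w, ‖M' w‖ ^ 2 ≤ (1 + ξ) * ‖(M ∘ₗ A) w‖ ^ 2 := by
    intro w
    have hg := tendsto_div_sq h'.contDiffAt h'.apply_zero h'.fderiv_zero w
    rw [h'.hessian] at hg
    have hs : Tendsto (fun s : ℝ => s) (𝓝[>] 0) (𝓝 0) := nhdsWithin_le_nhds
    have hsw : Tendsto (fun s : ℝ => s • w) (𝓝[>] 0) (𝓝 0) := by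
      simpa using hs.smul_const w
    have hfs : Tendsto (fun s : ℝ => f' (s • w)) (𝓝[>] 0) (𝓝 0) := by
      have := h'.contDiffAt.continuousAt.tendsto.comp hsw
      rwa [h'.apply_zero] at this
    have hz : Tendsto (fun s : ℝ => graphPoint x (u x) L' (s • w) (f' (s • w))) (𝓝[>] 0) (𝓝 x) := by
      have := ((continuous_graphPoint x (u x) L').tendsto ((0, 0) : Euc (n - 1) × ℝ)).comp
        (hsw.prodMk_nhds hfs)
      simpa [graphPoint, Function.comp_def] using this
    have hzv : Tendsto (fun s : ℝ => ‖P (graphPoint x (u x) L' (s • w) (f' (s • w)) - x₀)‖)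
        (𝓝[>] 0) (𝓝 ‖v₀‖) := by
      rw [← hPx]
      exact ((P.continuous.tendsto _).comp (hz.sub_const x₀)).norm
    have hzt : Tendsto (fun s : ℝ => |-⟪graphPoint x (u x) L' (s • w) (f' (s • w)) - x₀, u x₀⟫|)
        (𝓝[>] 0) (𝓝 |f v₀|) := by
      have hfx : f v₀ = -⟪x - x₀, u x₀⟫ := by
        rw [hxv]; exact (graphPoint_depth h.norm_normal h.inner_eq_zero _ _).symm
      rw [hfx]
      exact ((hz.sub_const x₀).inner tendsto_const_nhds).neg.abs
    have hlim2 : Tendsto (fun s : ℝ =>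
        (1 + ξ) / 2 * ‖M (A w - (f' (s • w) / s ^ 2 * s) • P (u x))‖ ^ 2) (𝓝[>] 0)
        (𝓝 ((1 + ξ) / 2 * ‖M (A w)‖ ^ 2)) := by
      have h1 : Tendsto (fun s : ℝ => A w - (f' (s • w) / s ^ 2 * s) • P (u x)) (𝓝[>] 0)
          (𝓝 (A w)) := by
        have := ((hg.mul hs).smul_const (P (u x))).const_sub (A w)
        simpa using this
      exact ((((hMc.tendsto _).comp h1).norm).pow 2).const_mul _
    have hle : ∀ᶠ s : ℝ in 𝓝[>] 0, f' (s • w) / s ^ 2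
        ≤ (1 + ξ) / 2 * ‖M (A w - (f' (s • w) / s ^ 2 * s) • P (u x))‖ ^ 2 := by
      filter_upwards [hzv.eventually (gt_mem_nhds hv₀),
        hzt.eventually (gt_mem_nhds (hq.abs_apply_lt v₀ hv₀)),
        hsw.norm.eventually (gt_mem_nhds (by simpa using h'.radius_pos)), self_mem_nhdsWithin]
        with s h1 h2 h3 h4
      have h4 : 0 < s := h4
      set z := graphPoint x (u x) L' (s • w) (f' (s • w)) with hz
      obtain ⟨v, t, hvt⟩ := h.span x₀ z
      have hv : P (z - x₀) = v := by rw [hvt]; exact graphPoint_base h.inner_eq_zero _ _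
      have ht : -⟪z - x₀, u x₀⟫ = t := by
        rw [hvt]; exact graphPoint_depth h.norm_normal h.inner_eq_zero _ _
      rw [hv] at h1
      rw [ht] at h2
      have hzf : z ∈ frontier S :=
        (h'.mem_frontier_iff _ _ h3 (h'.abs_apply_lt _ h3)).2 rfl
      have htf : t = f v := (hq.mem_frontier_iff v t h1 h2).1 (hvt ▸ hzf)
      have h5 := hin v t
      rw [← hvt] at h5
      have h6 : ⟪z - x, u x⟫ = -f' (s • w) := by
        rw [← graphPoint_depth (x := x) h'.norm_normal h'.inner_eq_zero (s • w) (f' (s • w)),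
          neg_neg]
      have h7 : v - v₀ = s • (A w - (f' (s • w) / s ^ 2 * s) • P (u x)) := by
        have e1 : z - x = s • (L' w) - f' (s • w) • u x := by
          rw [hz, graphPoint_sub, map_smul]
        have e2 : z - x₀ = (z - x) + (x - x₀) := by abel
        rw [← hv, e2, map_add, hPx, e1, map_sub, map_smul, map_smul, smul_sub, smul_smul, hAw,
          add_sub_cancel_right]
        congr 2
        field_simp
      have h8 := (abs_le.1 (hq.taylor v₀ v hv₀ h1)).2
      have h9 : f' (s • w) ≤ (1 + ξ) / 2 * ‖M (v - v₀)‖ ^ 2 := by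
        have e : f' (s • w) = a * (f v - f v₀ - fderiv ℝ f v₀ (v - v₀)) := by
          rw [h6, htf] at h5
          linarith
        rw [e]
        have e2 : f v - f v₀ - fderiv ℝ f v₀ (v - v₀) ≤ (1 + ξ) / 2 * ‖M (v - v₀)‖ ^ 2 := by
          linarith
        exact (mul_le_mul_of_nonneg_left e2 ha.le).trans
          (mul_le_of_le_one_left (by positivity) ha1)
      rw [h7, map_smul, norm_smul, mul_pow, Real.norm_of_nonneg h4.le] at h9
      rw [div_le_iff₀ (by positivity)]
      linarith
    have := le_of_tendsto_of_tendsto hg hlim2 hle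
    rw [LinearMap.comp_apply]
    linarith
  have h1 := det_sq_le_of_norm_sq_le M' (M ∘ₗ A) (by linarith : 0 < 1 + ξ) key
  have h2 : LinearMap.det A ^ 2 ≤ 1 :=
    (sq_le_one_iff_abs_le_one _).2 (abs_det_le_one_of_norm_le A hAn)
  rw [LinearMap.det_comp, mul_pow, finrank_euclideanSpace_fin] at h1
  rw [h'.curvature, h.curvature]
  refine h1.trans ?_
  gcongr
  exact mul_le_of_le_one_right (sq_nonneg _) h2

end Semicontinuity

section CapAsymptotics

variable {n : ℕ} {S : Set (Euc n)} {u : Euc n → Euc n} {κ : Euc n → ℝ}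

/-- The volume added to `S` by taking the convex hull with `x + Δ u(x)`. -/
def capVolume (S : Set (Euc n)) (u : Euc n → Euc n) (x : Euc n) (Δ : ℝ) : ℝ :=
  (volume (convexHull ℝ (S ∪ {x + Δ • u x}))).toReal - (volume S).toReal

/-- The leading term of the added volume. -/
def capLeading (κ : Euc n → ℝ) (x : Euc n) (Δ : ℝ) : ℝ :=
  (2*Δ) ^ (((n:ℝ)+1)/2) / ((n:ℝ)*((n:ℝ)+1)) *
    ((volume (ball (0 : Euc (n-1)) 1)).toReal / (κ x) ^ ((1:ℝ)/2))

theorem volume_unitBall_pos (m : ℕ) : 0 < (volume (ball (0 : Euc m) 1)).toReal :=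
  ENNReal.toReal_pos (measure_ball_pos _ _ one_pos).ne' measure_ball_lt_top.ne

theorem capLeading_pos (hn : 2 ≤ n) {x : Euc n} {Δ : ℝ} (hΔ : 0 < Δ) (hk : 0 < κ x) :
    0 < capLeading κ x Δ := by
  have := volume_unitBall_pos (n - 1)
  have hn0 : (0 : ℝ) < n := by exact_mod_cast (by omega : 0 < n)
  unfold capLeading
  positivity

/-- The ratio of the error term to the leading term of the added volume, per unit of error. -/
def errorConst (n : ℕ) : ℝ :=
  6 * (volume (closedBall (0 : Euc (n-1)) 2)).toReal * (n * (n + 1)) /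
    (volume (ball (0 : Euc (n-1)) 1)).toReal

theorem cap_region_bound_eq (hn : 2 ≤ n) {Δ ξ k D : ℝ} (hΔ : 0 < Δ) (hξ : 0 < ξ) (hD : D ≠ 0)
    {κ : Euc n → ℝ} {x : Euc n} (hk : k = κ x) (hk0 : 0 < k)
    (hkD : k ≤ (1 + ξ) ^ (n - 1) * D ^ 2) :
    √(2 * Δ) ^ (n - 1) * |D|⁻¹ * (Δ *
      ((volume (ball (0 : Euc (n - 1)) 1)).toReal *
        (2 / ((((n - 1 : ℕ) : ℝ) + 1) * ((n - 1 : ℕ) + 2))) +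
        12 * ξ * (volume (closedBall (0 : Euc (n - 1)) 2)).toReal))
    ≤ capLeading κ x Δ * (√((1 + ξ) ^ (n - 1)) * (1 + errorConst n * ξ)) := by
  have hω := volume_unitBall_pos (n - 1)
  unfold capLeading errorConst
  set ω := (volume (ball (0 : Euc (n - 1)) 1)).toReal
  set ω₂ := (volume (closedBall (0 : Euc (n - 1)) 2)).toReal with hω₂
  have hω₂0 : 0 ≤ ω₂ := ENNReal.toReal_nonneg
  have hn0 : (0 : ℝ) < n := by exact_mod_cast (by omega : 0 < n)
  have hcast : ((n - 1 : ℕ) : ℝ) = n - 1 := by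
    rw [Nat.cast_sub (by omega)]; simp
  have hpow : (2 * Δ) ^ (((n : ℝ) + 1) / 2) = √(2 * Δ) ^ (n - 1) * (2 * Δ) := by
    rw [Real.sqrt_eq_rpow, ← Real.rpow_natCast, ← Real.rpow_mul (by positivity), hcast]
    nth_rewrite 3 [← Real.rpow_one (2 * Δ)]
    rw [← Real.rpow_add (by positivity)]
    congr 1; ring
  rw [hpow, ← Real.sqrt_eq_rpow, ← hk]
  have hsk : 0 < √k := Real.sqrt_pos.2 hk0
  have hDpos : 0 < |D| := abs_pos.2 hD
  have hinv : |D|⁻¹ ≤ √((1 + ξ) ^ (n - 1)) / √k := by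
    rw [le_div_iff₀ hsk, inv_mul_le_iff₀ hDpos, ← Real.sqrt_sq_eq_abs, mul_comm,
      ← Real.sqrt_mul (by positivity)]
    exact Real.sqrt_le_sqrt hkD
  have hcast2 : (((n - 1 : ℕ) : ℝ) + 1) * ((n - 1 : ℕ) + 2) = n * (n + 1) := by
    rw [hcast]; ring
  rw [hcast2]
  refine (mul_le_mul_of_nonneg_right (mul_le_mul_of_nonneg_left hinv (by positivity))
    (by positivity)).trans (le_of_eq ?_)
  field_simp
  ring

theorem IsNearlyQuadratic.capVolume_le (hn : 2 ≤ n) (hS : IsSymConvexBody S) {x₀ : Euc n}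
    {L : Euc (n - 1) →ₗᵢ[ℝ] Euc n} {f : Euc (n - 1) → ℝ} {M : Euc (n - 1) →ₗ[ℝ] Euc (n - 1)}
    {ρ d C ξ : ℝ} (hq : IsNearlyQuadratic S x₀ (u x₀) L f ρ d M C ξ) (hν : ‖u x₀‖ = 1)
    (hL : ∀ v, ⟪L v, u x₀⟫ = 0) (hdet : LinearMap.det M ≠ 0) {x : Euc n} {v₀ : Euc (n - 1)}
    (hxv : x = graphPoint x₀ (u x₀) L v₀ (f v₀)) (hu : ‖u x‖ = 1) (hv₀ : ‖v₀‖ < ρ / 4)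
    (hfv₀ : |f v₀| < d / 4) (hk : 0 < κ x) (hkM : κ x ≤ (1 + ξ) ^ (n - 1) * LinearMap.det M ^ 2)
    {Δ : ℝ} (hΔ : 0 < Δ) (hCρ : C * √(2 * Δ) ≤ ρ / 16) (hCd : C * √(2 * Δ) ≤ d / 64)
    (hΔρ : Δ ≤ ρ / 16) (hΔd : Δ ≤ d / 64) :
    capVolume S u x Δ ≤
      capLeading κ x Δ * (√((1 + ξ) ^ (n - 1)) * (1 + errorConst n * ξ)) := by
  have hξ := hq.error_pos
  have hdim : Module.finrank ℝ (Euc n) = Module.finrank ℝ (Euc (n - 1)) + 1 := by simp; omega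
  have hspan : ∀ x' y, ∃ v t, y = graphPoint x' (u x₀) L v t :=
    exists_graphPoint_eq hν hL hdim
  have : Nontrivial (Euc (n - 1)) :=
    Module.nontrivial_of_finrank_pos (R := ℝ) (by simp; omega)
  obtain ⟨b, c, hbc⟩ := hspan x₀ (x₀ + u x)
  have hux : u x = L b - c • u x₀ := by
    rw [← graphPoint_sub x₀, ← hbc, add_sub_cancel_left]
  have hbcn : ‖b‖ ^ 2 + c ^ 2 = 1 := by
    have h1 := norm_sub_sq_real (L b) (c • u x₀)
    rw [← hux, hu, real_inner_smul_right, hL, L.norm_map, norm_smul, hν, mul_one,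
      Real.norm_eq_abs, sq_abs] at h1
    linarith
  have hb : ‖b‖ ≤ 1 := by nlinarith [norm_nonneg b, sq_nonneg c]
  have hc : |c| ≤ 1 := by
    rw [← sq_le_one_iff_abs_le_one]
    nlinarith [sq_nonneg ‖b‖]
  have hpt : x + Δ • u x = graphPoint x₀ (u x₀) L (v₀ + Δ • b) (f v₀ + Δ * c) := by
    rw [hxv, ← hxv, hux, hxv]
    simp only [graphPoint, map_add, map_smul]
    module
  obtain ⟨hDm, hDv⟩ := volume_cap_region_le M hdet (fderiv ℝ f v₀) v₀ (f v₀) hξ hq.error_le hΔ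
  set D := {p : Euc (n - 1) × ℝ | ‖M (p.1 - v₀)‖ / √(2 * Δ) ≤ 1 + 2 * ξ ∧
      Δ * (2 * (1 - ξ) * (‖M (p.1 - v₀)‖ / √(2 * Δ)) - 1 - 3 * ξ)
        ≤ p.2 - f v₀ - fderiv ℝ f v₀ (p.1 - v₀) ∧
      p.2 - f v₀ - fderiv ℝ f v₀ (p.1 - v₀)
        ≤ Δ * (1 + ξ) * (‖M (p.1 - v₀)‖ / √(2 * Δ)) ^ 2} with hD
  rw [← volume_image_graphPoint hν hL hdim x₀ hDm] at hDv
  set B := capLeading κ x Δ * (√((1 + ξ) ^ (n - 1)) * (1 + errorConst n * ξ)) with hB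
  have hE : 0 ≤ errorConst n := by unfold errorConst; positivity
  have hB0 : 0 ≤ B := by
    have := capLeading_pos hn hΔ hk
    positivity
  have hbound : volume ((fun p : Euc (n - 1) × ℝ => graphPoint x₀ (u x₀) L p.1 p.2) '' D)
      ≤ ENNReal.ofReal B := by
    refine hDv.trans (ENNReal.ofReal_le_ofReal ?_)
    rw [finrank_euclideanSpace_fin]
    exact cap_region_bound_eq hn hΔ hξ hdet rfl hk hkM
  have hsub : convexHull ℝ (S ∪ {x + Δ • u x}) ⊆
      S ∪ (fun p : Euc (n - 1) × ℝ => graphPoint x₀ (u x₀) L p.1 p.2) '' D := by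
    intro q hqm
    by_cases hqS : q ∈ S
    · exact Or.inl hqS
    · rw [hpt] at hqm
      obtain ⟨v, t, rfl, h1, h2, h3⟩ := hq.hull_diff hS.2.1 (hS.2.2.1.mono interior_subset)
        (hspan x₀) hb hc hΔ hv₀ hfv₀ hCρ hCd hΔρ hΔd hqm hqS
      exact Or.inr ⟨(v, t), ⟨h1, h2, h3⟩, rfl⟩
  have hvol : volume (convexHull ℝ (S ∪ {x + Δ • u x})) ≤
      ENNReal.ofReal ((volume S).toReal + B) := by
    rw [ENNReal.ofReal_add ENNReal.toReal_nonneg hB0, ENNReal.ofReal_toReal hS.1.measure_ne_top]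
    exact (measure_mono hsub).trans ((measure_union_le _ _).trans (by gcongr))
  have := ENNReal.toReal_le_of_le_ofReal (by positivity) hvol
  unfold capVolume
  linarith

theorem exists_local_capVolume_le (hn : 2 ≤ n) (hS : IsSymConvexBody S) (hC2 : IsC2Body S u κ)
    (hκ : ∀ x ∈ frontier S, 0 < κ x) {x₀ : Euc n} (hx₀ : x₀ ∈ frontier S) {ξ : ℝ} (hξ : 0 < ξ)
    (hξ' : ξ ≤ 1 / 10) :
    ∃ U ∈ 𝓝 x₀, ∃ Δ₀ > 0, ∀ x ∈ frontier S, x ∈ U → ∀ Δ, 0 < Δ → Δ ≤ Δ₀ →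
      capVolume S u x Δ ≤
        capLeading κ x Δ * (√((1 + ξ) ^ (n - 1)) * (1 + errorConst n * ξ)) := by
  obtain ⟨L, f, M, ρ₁, d, h⟩ := exists_isChart hn hS hC2 hx₀
  obtain ⟨ρ, C, -, hdiff, hq⟩ := h.exists_isNearlyQuadratic hC2 (hκ x₀ hx₀) hξ hξ'
  have hdet : LinearMap.det M ≠ 0 := by
    intro h0
    have := hκ x₀ hx₀
    rw [h.curvature, h0] at this
    norm_num at this
  have hρ := hq.radius_pos
  have hd := hq.height_pos
  set P := L.toContinuousLinearMap.adjoint with hP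
  have hU : ∀ᶠ x in 𝓝 x₀, ‖P (x - x₀)‖ < ρ / 4 ∧ |-⟪x - x₀, u x₀⟫| < d / 4 := by
    have h1 : Tendsto (fun x => ‖P (x - x₀)‖) (𝓝 x₀) (𝓝 0) := by
      have : Continuous fun x => ‖P (x - x₀)‖ := by fun_prop
      simpa using this.tendsto x₀
    have h2 : Tendsto (fun x => |-⟪x - x₀, u x₀⟫|) (𝓝 x₀) (𝓝 0) := by
      have : Continuous fun x => |-⟪x - x₀, u x₀⟫| := by fun_prop
      simpa using this.tendsto x₀
    exact (h1.eventually (gt_mem_nhds (by linarith))).and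
      (h2.eventually (gt_mem_nhds (by linarith)))
  have hsmall : ∀ᶠ Δ : ℝ in 𝓝[>] 0, (C * √(2 * Δ) < ρ / 16 ∧ C * √(2 * Δ) < d / 64) ∧
      Δ < ρ / 16 ∧ Δ < d / 64 := by
    have h1 : Tendsto (fun Δ : ℝ => C * √(2 * Δ)) (𝓝[>] 0) (𝓝 0) := by
      have : Continuous fun Δ : ℝ => C * √(2 * Δ) := by fun_prop
      simpa using (this.tendsto 0).mono_left nhdsWithin_le_nhds
    have h2 : Tendsto (fun Δ : ℝ => Δ) (𝓝[>] 0) (𝓝 0) := nhdsWithin_le_nhds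
    exact ((h1.eventually (gt_mem_nhds (by linarith))).and
      (h1.eventually (gt_mem_nhds (by linarith)))).and
      ((h2.eventually (gt_mem_nhds (by linarith))).and
      (h2.eventually (gt_mem_nhds (by linarith))))
  obtain ⟨Δ₀, hΔ₀, hsub⟩ := mem_nhdsGT_iff_exists_Ioc_subset.1 hsmall
  refine ⟨_, hU, Δ₀, hΔ₀, fun x hx hxU Δ hΔ hΔle => ?_⟩
  obtain ⟨⟨a1, a2⟩, a3, a4⟩ := hsub ⟨hΔ, hΔle⟩
  obtain ⟨hxU1, hxU2⟩ := hxU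
  obtain ⟨v₀, t, hvt⟩ := h.span x₀ x
  have hv : P (x - x₀) = v₀ := by rw [hvt]; exact graphPoint_base h.inner_eq_zero _ _
  have ht : -⟪x - x₀, u x₀⟫ = t := by
    rw [hvt]; exact graphPoint_depth h.norm_normal h.inner_eq_zero _ _
  rw [hv] at hxU1
  rw [ht] at hxU2
  obtain rfl : t = f v₀ :=
    (hq.mem_frontier_iff v₀ t (by linarith) (by linarith)).1 (hvt ▸ hx)
  obtain ⟨L', f', M', ρ', d', h'⟩ := exists_isChart hn hS hC2 hx
  refine hq.capVolume_le hn hS h.norm_normal h.inner_eq_zero hdet hvt (hC2 x hx).1.1 hxU1 hxU2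
    (hκ x hx) ?_ hΔ a1.le a2.le a3.le a4.le
  rw [← h.curvature]
  exact h.curvature_le hq hdiff hC2 hx (by linarith) hvt h'

theorem exists_capVolume_le (hn : 2 ≤ n) (hS : IsSymConvexBody S) (hC2 : IsC2Body S u κ)
    (hκ : ∀ x ∈ frontier S, 0 < κ x) {η : ℝ} (hη : 0 < η) :
    ∃ Δ₀ > 0, ∀ x ∈ frontier S, ∀ Δ, 0 < Δ → Δ ≤ Δ₀ →
      capVolume S u x Δ ≤ capLeading κ x Δ * (1 + η) := by
  obtain ⟨ξ, hξη, hξ, hξ'⟩ : ∃ ξ : ℝ,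
      √((1 + ξ) ^ (n - 1)) * (1 + errorConst n * ξ) < 1 + η ∧ 0 < ξ ∧ ξ < 1 / 10 := by
    have h1 : Tendsto (fun ξ : ℝ => √((1 + ξ) ^ (n - 1)) * (1 + errorConst n * ξ)) (𝓝[>] 0)
        (𝓝 1) := by
      have : Continuous fun ξ : ℝ => √((1 + ξ) ^ (n - 1)) * (1 + errorConst n * ξ) := by fun_prop
      simpa using (this.tendsto 0).mono_left nhdsWithin_le_nhds
    have h2 : Tendsto (fun ξ : ℝ => ξ) (𝓝[>] 0) (𝓝 0) := nhdsWithin_le_nhds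
    have h3 : ∀ᶠ ξ : ℝ in 𝓝[>] 0, 0 < ξ := self_mem_nhdsWithin
    exact ((h1.eventually (gt_mem_nhds (by linarith))).and
      (h3.and (h2.eventually (gt_mem_nhds (by norm_num))))).exists
  have hK : IsCompact (frontier S) :=
    hS.1.of_isClosed_subset isClosed_frontier hS.1.isClosed.frontier_subset
  have := hK.induction_on (p := fun s => ∃ Δ₀ > 0, ∀ x ∈ frontier S, x ∈ s → ∀ Δ, 0 < Δ →
      Δ ≤ Δ₀ → capVolume S u x Δ ≤ capLeading κ x Δ * (1 + η)) ⟨1, one_pos, by simp⟩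
    (fun s t hst ⟨Δ₀, h0, h⟩ => ⟨Δ₀, h0, fun x hx hxs => h x hx (hst hxs)⟩)
    (fun s t ⟨Δ₀, h0, h⟩ ⟨Δ₁, h1, h'⟩ => ⟨min Δ₀ Δ₁, lt_min h0 h1, fun x hx hxs Δ hΔ hle =>
      hxs.elim (fun hxs => h x hx hxs Δ hΔ (hle.trans (min_le_left _ _)))
        fun hxs => h' x hx hxs Δ hΔ (hle.trans (min_le_right _ _))⟩)
    (fun x₀ hx₀ => by
      obtain ⟨U, hU, Δ₀, hΔ₀, h⟩ := exists_local_capVolume_le hn hS hC2 hκ hx₀ hξ hξ'.le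
      refine ⟨U, mem_nhdsWithin_of_mem_nhds hU, Δ₀, hΔ₀, fun x hx hxU Δ hΔ hle =>
        (h x hx hxU Δ hΔ hle).trans ?_⟩
      exact mul_le_mul_of_nonneg_left hξη.le (capLeading_pos hn hΔ (hκ x hx)).le)
  obtain ⟨Δ₀, h0, h⟩ := this
  exact ⟨Δ₀, h0, fun x hx => h x hx hx⟩

end CapAsymptotics

/-- Lemma 2.10 (3): for `S` of class `C²₊` there is a nonnegative function `ψ` with `ψ(Δ) → 0`
such that for every `x ∈ ∂S` and all small `Δ > 0`,
`|conv(S ∪ {x + Δu(x)})|ₙ − |S|ₙ ≤ ((2Δ)^{(n+1)/2}/(n(n+1)))·|B₂^{n−1}|/κ(x)^{1/2}·(1 + ψ(Δ))`. -/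
theorem statement16 {n : ℕ} (hn : 2 ≤ n) (S : Set (Euc n))
    (u : Euc n → Euc n) (κ : Euc n → ℝ)
    (hS : IsSymConvexBody S) (hC2 : IsC2Body S u κ)
    (hκ : ∀ x ∈ frontier S, 0 < κ x) :
    ∃ ψ : ℝ → ℝ, (∀ Δ, 0 ≤ ψ Δ) ∧ Tendsto ψ (𝓝[>] 0) (𝓝 0) ∧
      ∃ Δ₀ > (0:ℝ), ∀ x ∈ frontier S, ∀ Δ : ℝ, 0 < Δ → Δ ≤ Δ₀ →
        (volume (convexHull ℝ (S ∪ {x + Δ • u x}))).toReal - (volume S).toReal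
          ≤ (2*Δ) ^ (((n:ℝ)+1)/2) / ((n:ℝ)*((n:ℝ)+1)) *
            ((volume (ball (0 : Euc (n-1)) 1)).toReal / (κ x) ^ ((1:ℝ)/2)) * (1 + ψ Δ) := by
  set A : ℝ → Set ℝ := fun Δ =>
    {η | 0 ≤ η ∧ ∀ x ∈ frontier S, capVolume S u x Δ ≤ capLeading κ x Δ * (1 + η)} with hA
  have hbdd : ∀ Δ, BddBelow (A Δ) := fun Δ => ⟨0, fun η hη => hη.1⟩
  have hnonneg : ∀ Δ, 0 ≤ sInf (A Δ) := fun Δ => Real.sInf_nonneg fun η hη => hη.1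
  refine ⟨fun Δ => sInf (A Δ), hnonneg, ?_, ?_⟩
  · rw [Metric.tendsto_nhds]
    intro η hη
    obtain ⟨Δ₀, hΔ₀, h⟩ := exists_capVolume_le hn hS hC2 hκ (half_pos hη)
    filter_upwards [Ioc_mem_nhdsGT hΔ₀] with Δ hΔ
    rw [Real.dist_0_eq_abs, abs_of_nonneg (hnonneg Δ)]
    have : sInf (A Δ) ≤ η / 2 :=
      csInf_le (hbdd Δ) ⟨(half_pos hη).le, fun x hx => h x hx Δ hΔ.1 hΔ.2⟩
    linarith
  · obtain ⟨Δ₀, hΔ₀, h⟩ := exists_capVolume_le hn hS hC2 hκ one_pos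
    refine ⟨Δ₀, hΔ₀, fun x hx Δ hΔ hle => ?_⟩
    have hpos := capLeading_pos hn hΔ (hκ x hx)
    have hinf : capVolume S u x Δ / capLeading κ x Δ - 1 ≤ sInf (A Δ) := by
      refine le_csInf ⟨1, zero_le_one, fun y hy => h y hy Δ hΔ hle⟩ fun η hη => ?_
      have := hη.2 x hx
      rw [mul_comm, ← div_le_iff₀ hpos] at this
      linarith
    change capVolume S u x Δ ≤ capLeading κ x Δ * (1 + sInf (A Δ))
    rw [mul_comm, ← div_le_iff₀ hpos]
    linarith
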